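/- Let k, l be natural numbers with 1 < k ≤ l and m = k + l − 1. Let G be a bipartite graph on vertex classes A and B in which every vertex of A has degree divisible by m. If G is 3l·⌈2m/(k−1)⌉-edge-connected, then E(G) can be partitioned into two subgraphs G1 and G2 such that d(v,G1) = ((k−1)/m)·d(v,G) for every v ∈ A, and l divides d(v,G2) for every v ∈ B. -/

import Mathlib

/-- A loopless multigraph on vertex type `V` with edge type `E`. -/
structure Multigraph (V : Type) (E : Type) where
  ends : E → Sym2 V
  loopless : ∀ e, ¬ (ends e).IsDiag

namespace Multigraph

variable {V E : Type}

/-- Degree of a vertex. -/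
noncomputable def deg (G : Multigraph V E) (v : V) : ℕ :=
  Nat.card {e : E // v ∈ G.ends e}

/-- Degree of a vertex in the spanning subgraph with edge set `H`. -/
noncomputable def degOn (G : Multigraph V E) (H : Set E) (v : V) : ℕ :=
  Nat.card {e : E // e ∈ H ∧ v ∈ G.ends e}

/-- Degree of `v` in colour `j` under the edge-colouring `c`. -/
noncomputable def degCol {C : Type} (G : Multigraph V E) (c : E → C) (j : C) (v : V) : ℕ :=
  Nat.card {e : E // c e = j ∧ v ∈ G.ends e}

/-- Adjacency using only edges from `F`. -/
def Adj (G : Multigraph V E) (F : Set E) (v w : V) : Prop :=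
  ∃ e ∈ F, G.ends e = s(v, w)

/-- The spanning subgraph with edge set `F` is connected (on all of `V`). -/
def ConnectedOn (G : Multigraph V E) (F : Set E) : Prop :=
  ∀ v w : V, Relation.ReflTransGen (G.Adj F) v w

/-- `G` is connected. -/
def Connected (G : Multigraph V E) : Prop := G.ConnectedOn Set.univ

/-- `G` is `k`-edge-connected: removing fewer than `k` edges leaves it connected. -/
def EdgeConnected (G : Multigraph V E) (k : ℕ) : Prop :=
  ∀ F : Finset E, F.card < k → G.ConnectedOn {e | e ∉ F}

/-- The spanning subgraph with edge set `H` is `k`-edge-connected. -/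
def EdgeConnectedOn (G : Multigraph V E) (H : Set E) (k : ℕ) : Prop :=
  ∀ F : Finset E, ↑F ⊆ H → F.card < k → G.ConnectedOn (H \ ↑F)

/-- `S` is the edge set of a spanning tree of `G`. -/
def IsSpanningTree (G : Multigraph V E) (S : Set E) : Prop :=
  G.ConnectedOn S ∧ Nat.card S + 1 = Nat.card V

/-- `G` is a tree (connected with one fewer edge than vertices). -/
def IsTree (G : Multigraph V E) : Prop :=
  G.Connected ∧ Nat.card E + 1 = Nat.card V

/-- `H` is a homomorphic copy of `G`: it is obtained from `G` by identifying vertices,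
keeping all edges (the vertex map is surjective and induces a bijection on edges). -/
def IsHomCopy {V' E' : Type} (G : Multigraph V E) (H : Multigraph V' E') : Prop :=
  ∃ (f : V → V') (g : E ≃ E'), Function.Surjective f ∧
    ∀ e, H.ends (g e) = (G.ends e).map f

/-- `G` and `H` are isomorphic multigraphs. -/
def IsIsomorphic {V' E' : Type} (G : Multigraph V E) (H : Multigraph V' E') : Prop :=
  ∃ (f : V ≃ V') (g : E ≃ E'), ∀ e, H.ends (g e) = (G.ends e).map f

/-- The edge set `S` of `G` forms a subgraph which is a homomorphic copy of `T`. -/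
def IsHomCopyOn {VT ET : Type} (T : Multigraph VT ET) (G : Multigraph V E) (S : Set E) : Prop :=
  ∃ (f : VT → V) (g : ET ≃ S), ∀ e, G.ends (g e) = (T.ends e).map f

/-- The edge set `S` of `G` forms a subgraph isomorphic to `T`. -/
def IsIsoCopyOn {VT ET : Type} (T : Multigraph VT ET) (G : Multigraph V E) (S : Set E) : Prop :=
  ∃ (f : VT → V) (g : ET ≃ S), Function.Injective f ∧
    ∀ e, G.ends (g e) = (T.ends e).map f

/-- `A`, `B` form a bipartition of `G`. -/
def IsBipartition (G : Multigraph V E) (A B : Set V) : Prop :=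
  Disjoint A B ∧ A ∪ B = Set.univ ∧ ∀ e : E, ∃ a ∈ A, ∃ b ∈ B, G.ends e = s(a, b)

/-- A `T*`-decomposition: a partition of the edge set of `G` into homomorphic copies of `T`. -/
def HomCopyDecomposition {VT ET : Type} (T : Multigraph VT ET) (G : Multigraph V E) : Prop :=
  ∃ P : Set (Set E), Setoid.IsPartition P ∧ ∀ S ∈ P, T.IsHomCopyOn G S

/-- A `T`-decomposition: a partition of the edge set of `G` into copies isomorphic to `T`. -/
def IsoCopyDecomposition {VT ET : Type} (T : Multigraph VT ET) (G : Multigraph V E) : Prop :=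
  ∃ P : Set (Set E), Setoid.IsPartition P ∧ ∀ S ∈ P, T.IsIsoCopyOn G S

/-- There is a walk of length `n` from `v` to `w` in `G`. -/
def WalkLen (G : Multigraph V E) (n : ℕ) (v w : V) : Prop :=
  ∃ (p : Fin (n + 1) → V) (e : Fin n → E), p 0 = v ∧ p (Fin.last n) = w ∧
    ∀ i : Fin n, G.ends (e i) = s(p i.castSucc, p i.succ)

/-- Graph distance. -/
noncomputable def dist (G : Multigraph V E) (v w : V) : ℕ :=
  sInf {n | G.WalkLen n v w}

/-- Diameter of a finite graph. -/
noncomputable def diam (G : Multigraph V E) [Fintype V] : ℕ :=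
  Finset.univ.sup fun p : V × V => G.dist p.1 p.2

/-- `G` contains a cycle of length `n`. -/
def HasCycleOfLength (G : Multigraph V E) (n : ℕ) : Prop :=
  2 ≤ n ∧ ∃ (v : ZMod n → V) (e : ZMod n → E), Function.Injective v ∧ Function.Injective e ∧
    ∀ i, G.ends (e i) = s(v i, v (i + 1))

end Multigraph

namespace ModFlow

variable {U : Type} [DecidableEq U]

/-- The total weight between `X` and the rest of `N`. -/
def cut (N : Finset U) (w : U → U → ℤ) (X : Finset U) : ℤ :=
  ∑ a ∈ X, ∑ b ∈ N \ X, w a b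

/-- The row sum of `w` at `a`, over the nodes in `N`. -/
def deg (N : Finset U) (w : U → U → ℤ) (a : U) : ℤ := ∑ b ∈ N, w a b

/-- The unit weight on the edge `ab`. -/
def link (a b u v : U) : ℤ :=
  (if u = a then (if v = b then 1 else 0) else 0) + if u = b then (if v = a then 1 else 0) else 0

/-- The unit flow along the edge `ab`. -/
def arc (a b u v : U) : ℤ :=
  (if u = a then (if v = b then 1 else 0) else 0) - if u = b then (if v = a then 1 else 0) else 0

lemma link_comm (a b u v : U) : link a b u v = link a b v u := by
  unfold link; split_ifs <;> simp_all

lemma link_nonneg (a b u v : U) : 0 ≤ link a b u v := by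
  unfold link; split_ifs <;> simp

lemma link_self {a b : U} (h : a ≠ b) (u : U) : link a b u u = 0 := by
  unfold link; split_ifs <;> simp_all

lemma arc_comm (a b u v : U) : arc a b u v = - arc a b v u := by
  unfold arc; split_ifs <;> simp_all

lemma deg_add_link {N : Finset U} (w : U → U → ℤ) (t : ℤ) {a b : U} (ha : a ∈ N) (hb : b ∈ N)
    (u : U) :
    deg N (fun u v => w u v + t * link a b u v) u =
      deg N w u + t * ((if u = a then 1 else 0) + if u = b then 1 else 0) := by
  simp only [deg, link, Finset.sum_add_distrib, ← Finset.mul_sum]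
  congr 2
  by_cases h1 : u = a <;> by_cases h2 : u = b <;> simp_all

lemma deg_add_arc {N : Finset U} (w : U → U → ℤ) (t : ℤ) {a b : U} (ha : a ∈ N) (hb : b ∈ N)
    (u : U) :
    deg N (fun u v => w u v + t * arc a b u v) u =
      deg N w u + t * ((if u = a then 1 else 0) - if u = b then 1 else 0) := by
  simp only [deg, arc, Finset.sum_add_distrib, Finset.sum_sub_distrib, ← Finset.mul_sum]
  congr 2
  by_cases h1 : u = a <;> by_cases h2 : u = b <;> simp_all

lemma cut_add_link {N X : Finset U} (w : U → U → ℤ) (t : ℤ) {a b : U} (ha : a ∈ N) (hb : b ∈ N) :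
    cut N (fun u v => w u v + t * link a b u v) X =
      cut N w X + t * (if (a ∈ X ↔ b ∈ X) then 0 else 1) := by
  have h : ∀ c d : U, d ∈ N →
      ∑ u ∈ X, ∑ v ∈ N \ X, (if u = c then (if v = d then (1 : ℤ) else 0) else 0) =
        if c ∈ X ∧ d ∉ X then 1 else 0 := by
    intro c d hd
    have h1 : ∀ u, ∑ v ∈ N \ X, (if u = c then (if v = d then (1 : ℤ) else 0) else 0) =
        if u = c then (if d ∈ X then 0 else 1) else 0 := by
      intro u
      by_cases hu : u = c <;> by_cases hdX : d ∈ X <;> simp [hu, hdX, hd]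
    simp only [h1, Finset.sum_ite_eq']
    by_cases hc : c ∈ X <;> by_cases hdX : d ∈ X <;> simp [hc, hdX]
  simp only [cut, link, Finset.sum_add_distrib, ← Finset.mul_sum, h _ _ ha, h _ _ hb]
  congr 2
  by_cases h1 : a ∈ X <;> by_cases h2 : b ∈ X <;> simp_all

lemma cut_singleton {N : Finset U} {w : U → U → ℤ} (hd : ∀ a, w a a = 0) {a : U} (ha : a ∈ N) :
    cut N w {a} = deg N w a := by
  simp only [cut, deg, Finset.sum_singleton]
  rw [← Finset.add_sum_erase N _ ha, hd, zero_add, Finset.sdiff_singleton_eq_erase]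

lemma cut_insert {N X : Finset U} {w : U → U → ℤ} (hs : ∀ a b, w a b = w b a)
    (hd : ∀ a, w a a = 0) (hX : X ⊆ N) {z : U} (hz : z ∈ N) (hzX : z ∉ X) :
    cut N w (insert z X) = cut N w X + deg N w z - 2 * ∑ b ∈ X, w z b := by
  have h1 : N \ X = insert z (N \ insert z X) := by
    ext b; by_cases hb : b = z <;> simp_all
  have h2 : z ∉ N \ insert z X := by simp
  have h3 : deg N w z = ∑ b ∈ X, w z b + ∑ b ∈ N \ insert z X, w z b := by
    rw [deg, ← Finset.sum_sdiff hX, h1, Finset.sum_insert h2, hd]; ring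
  have h4 : cut N w X = ∑ b ∈ X, w z b + ∑ a ∈ X, ∑ b ∈ N \ insert z X, w a b := by
    rw [cut, h1]
    simp only [Finset.sum_insert h2, Finset.sum_add_distrib, hs _ z]
  rw [h3, h4, cut, Finset.sum_insert hzX]; ring

/-- A weighted graph with flow targets: at the vertices of `V` the target `r` is prescribed modulo
`2k`, at those of `Z` exactly. The ghost weights `g` only contribute to the cut conditions, which
are relaxed at the vertices in `low`. -/
structure Net (U : Type) where
  V : Finset U
  Z : Finset U
  low : Finset U
  w : U → U → ℤ
  g : U → ℤ
  r : U → ℤ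

namespace Net

/-- All nodes of a net. -/
def N (s : Net U) : Finset U := s.V ∪ s.Z

/-- Cut weight including ghost weights. -/
def F (s : Net U) (X : Finset U) : ℤ := cut s.N s.w X + ∑ a ∈ X, s.g a

/-- The lower bound for cuts isolating the single vertex `y` of `V`. -/
def c (s : Net U) (k : ℤ) (y : U) : ℤ := if y ∈ s.low then 7 * k else 9 * k

/-- Total weight together with the number of exact nodes. -/
def size (s : Net U) : ℤ := s.Z.card + ∑ a ∈ s.N, deg s.N s.w a

/-- There is an antisymmetric flow bounded by `w`, congruent to `w` mod `2`, that meets the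
targets. -/
def Sol (k : ℤ) (s : Net U) : Prop :=
  ∃ ν : U → U → ℤ, (∀ a b, ν a b = - ν b a) ∧
    (∀ a ∈ s.N, ∀ b ∈ s.N, |ν a b| ≤ s.w a b ∧ 2 ∣ s.w a b - ν a b) ∧
    (∀ a ∈ s.V, 2 * k ∣ deg s.N ν a - s.r a) ∧ ∀ z ∈ s.Z, deg s.N ν z = s.r z

/-- The invariant maintained while reducing a net. -/
structure Valid (k : ℤ) (s : Net U) : Prop where
  disj : Disjoint s.V s.Z
  nonempty : s.V.Nonempty
  symm : ∀ a b, s.w a b = s.w b a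
  nonneg : ∀ a b, 0 ≤ s.w a b
  diag : ∀ a, s.w a a = 0
  ghost : ∀ a, 0 ≤ s.g a
  zz : ∀ a ∈ s.Z, ∀ b ∈ s.Z, s.w a b = 0
  parity : ∀ a ∈ s.N, 2 ∣ deg s.N s.w a - s.r a
  sum : 2 * k ∣ ∑ a ∈ s.N, s.r a
  ghost_sum : ∑ a ∈ s.N, s.g a ≤ 12 * k
  z_abs : ∀ z ∈ s.Z, |s.r z| ≤ s.g z
  z_le : ∀ z ∈ s.Z, s.g z ≤ deg s.N s.w z
  z_even : ∀ z ∈ s.Z, 2 ∣ deg s.N s.w z + s.g z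
  v_abs : ∀ y ∈ s.V, |s.r y| ≤ 2 * k + s.g y
  low_pos : ∀ x ∈ s.V, ∀ y ∈ s.V, x ∈ s.low → y ∈ s.low → x ≠ y →
    ¬ (s.g x < s.r x ∧ s.g y < s.r y)
  low_neg : ∀ x ∈ s.V, ∀ y ∈ s.V, x ∈ s.low → y ∈ s.low → x ≠ y →
    ¬ (s.r x < - s.g x ∧ s.r y < - s.g y)
  single : ∀ X ⊆ s.N, ∀ y, X ∩ s.V = {y} → s.V ≠ {y} →
    s.c k y ≤ s.F X ∧ s.c k y + |s.r y| ≤ s.F X + s.g y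
  multi : ∀ X ⊆ s.N, 2 ≤ (X ∩ s.V).card → X ∩ s.V ≠ s.V → 11 * k ≤ s.F X

/-- All nontrivial cuts have weight more than `12k`. -/
def Slack (k : ℤ) (s : Net U) : Prop :=
  ∀ X ⊆ s.N, 2 ≤ (X ∩ s.V).card → X ∩ s.V ≠ s.V → 12 * k < s.F X

/-- The well-founded order used for the induction on nets. -/
def Smaller (s t : Net U) : Prop :=
  s.V.card < t.V.card ∨ s.V.card = t.V.card ∧
    ((s.V \ s.low).card < (t.V \ t.low).card ∨
      (s.V \ s.low).card = (t.V \ t.low).card ∧ s.size.toNat < t.size.toNat)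

lemma smaller_wf : WellFounded (Smaller (U := U)) := by
  have h := (Nat.lt_wfRel.wf).prod_lex ((Nat.lt_wfRel.wf).prod_lex Nat.lt_wfRel.wf)
  refine Subrelation.wf ?_ (InvImage.wf
    (fun s : Net U => (s.V.card, (s.V \ s.low).card, s.size.toNat)) h)
  intro s t hst
  simp only [InvImage]
  rw [Prod.lex_def, Prod.lex_def]
  exact hst

lemma mem_N {s : Net U} {a : U} : a ∈ s.N ↔ a ∈ s.V ∨ a ∈ s.Z := by simp [N]

lemma Valid.deg_nonneg {k : ℤ} {s : Net U} (h : s.Valid k) (a : U) : 0 ≤ deg s.N s.w a :=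
  Finset.sum_nonneg fun b _ => h.nonneg a b

lemma Valid.size_nonneg {k : ℤ} {s : Net U} (h : s.Valid k) : 0 ≤ s.size := by
  have := Finset.sum_nonneg fun a (_ : a ∈ s.N) => h.deg_nonneg a
  unfold size; positivity

lemma Valid.le_deg {k : ℤ} {s : Net U} (h : s.Valid k) (a : U) {b : U} (hb : b ∈ s.N) :
    s.w a b ≤ deg s.N s.w a :=
  Finset.single_le_sum (f := s.w a) (fun b _ => h.nonneg a b) hb

/-- Moving an exact node `z` into `X`. -/
lemma Valid.F_insert {k : ℤ} {s : Net U} (h : s.Valid k) {X : Finset U} (hX : X ⊆ s.N) {z : U}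
    (hz : z ∈ s.N) (hzX : z ∉ X) :
    s.F (insert z X) = s.F X + (deg s.N s.w z + s.g z) - 2 * ∑ b ∈ X, s.w z b := by
  rw [F, F, cut_insert h.symm h.diag hX hz hzX, Finset.sum_insert hzX]; ring

lemma Valid.F_erase {k : ℤ} {s : Net U} (h : s.Valid k) {X : Finset U} (hX : X ⊆ s.N) {z : U}
    (hzX : z ∈ X) :
    s.F X = s.F (X.erase z) + (deg s.N s.w z + s.g z) - 2 * ∑ b ∈ X.erase z, s.w z b := by
  rw [← h.F_insert ((Finset.erase_subset z X).trans hX) (hX hzX) (Finset.notMem_erase z X),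
    Finset.insert_erase hzX]

lemma Valid.sum_Z {k : ℤ} {s : Net U} (h : s.Valid k) {X : Finset U} (hX : X ⊆ s.N) {z : U}
    (hz : z ∈ s.Z) : ∑ b ∈ X, s.w z b = ∑ b ∈ X ∩ s.V, s.w z b := by
  symm
  apply Finset.sum_subset Finset.inter_subset_left
  intro b hb hb'
  rcases mem_N.1 (hX hb) with h1 | h1
  · exact absurd (Finset.mem_inter.2 ⟨hb, h1⟩) hb'
  · exact h.zz _ hz _ h1

lemma Valid.deg_Z {k : ℤ} {s : Net U} (h : s.Valid k) {z : U}
    (hz : z ∈ s.Z) : deg s.N s.w z = ∑ b ∈ s.V, s.w z b := by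
  rw [deg, h.sum_Z subset_rfl hz]
  congr 1
  ext a; simp [mem_N]; tauto

lemma sum_deg_add_link {N : Finset U} (w : U → U → ℤ) (t : ℤ) {a b : U} (ha : a ∈ N) (hb : b ∈ N) :
    ∑ u ∈ N, deg N (fun u v => w u v + t * link a b u v) u = ∑ u ∈ N, deg N w u + 2 * t := by
  simp only [deg_add_link w t ha hb, Finset.sum_add_distrib, ← Finset.mul_sum,
    Finset.sum_ite_eq', ha, hb, if_true]
  ring

lemma link_eq_one {a b : U} (h : a ≠ b) : link a b a b = 1 := by
  simp [link, h]

lemma link_eq_zero {a b u v : U} (h1 : ¬ (u = a ∧ v = b)) (h2 : ¬ (u = b ∧ v = a)) :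
    link a b u v = 0 := by
  unfold link; split_ifs <;> simp_all

lemma link_cases {a b : U} (h : a ≠ b) (u v : U) :
    (u = a ∧ v = b ∧ link a b u v = 1 ∧ arc a b u v = 1) ∨
    (u = b ∧ v = a ∧ link a b u v = 1 ∧ arc a b u v = -1) ∨
    (¬ (u = a ∧ v = b) ∧ ¬ (u = b ∧ v = a) ∧ link a b u v = 0 ∧ arc a b u v = 0) := by
  unfold link arc; split_ifs <;> simp_all

lemma nonneg_sub_link {w : U → U → ℤ} (hs : ∀ a b, w a b = w b a) (hn : ∀ a b, 0 ≤ w a b)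
    {a b : U} (hab : a ≠ b) {t : ℤ} (h : t ≤ w a b) (u v : U) :
    0 ≤ w u v + (-t) * link a b u v := by
  have := hn u v
  rcases link_cases hab u v with ⟨rfl, rfl, h1, -⟩ | ⟨rfl, rfl, h1, -⟩ | ⟨-, -, h1, -⟩
  · rw [h1]; linarith
  · rw [h1, hs]; linarith
  · rw [h1]; linarith

/-- Routing `φ` units along the edge `cd`. -/
lemma Sol.of_link {k : ℤ} {s t : Net U} {c d : U} (hcd : c ≠ d) (hc : c ∈ s.N) (hd : d ∈ s.N)
    (hV : t.V = s.V) (hZ : t.Z = s.Z) (hw : t.w = fun u v => s.w u v + (-1) * link c d u v)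
    {φ : ℤ} (hφ : φ = 1 ∨ φ = -1)
    (hr : ∀ u, t.r u = s.r u - φ * ((if u = c then 1 else 0) - if u = d then 1 else 0))
    (h : t.Sol k) : s.Sol k := by
  have hN : t.N = s.N := by simp [N, hV, hZ]
  obtain ⟨ν, h1, h2, h3, h4⟩ := h
  rw [hV, hN] at h3
  rw [hZ, hN] at h4
  rw [hN, hw] at h2
  refine ⟨fun u v => ν u v + φ * arc c d u v, ?_, ?_, ?_, ?_⟩
  · intro a b; simp only; rw [h1, arc_comm]; ring
  · intro a ha b hb
    obtain ⟨h5, h6⟩ := h2 a ha b hb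
    simp only at h5 h6
    rw [abs_le] at h5 ⊢
    rcases link_cases hcd a b with ⟨-, -, e1, e2⟩ | ⟨-, -, e1, e2⟩ | ⟨-, -, e1, e2⟩ <;>
    rw [e1] at h5 h6 <;> simp only [e2] <;> rcases hφ with rfl | rfl <;> omega
  · intro a ha
    have := h3 a ha
    rw [hr] at this
    rw [deg_add_arc ν φ hc hd]
    convert this using 1; ring
  · intro a ha
    have := h4 a ha
    rw [hr] at this
    rw [deg_add_arc ν φ hc hd]
    linarith

/-- `s` can be replaced by a smaller valid net. -/
def Reducible (k : ℤ) (s : Net U) : Prop :=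
  ∃ t : Net U, t.Valid k ∧ t.Smaller s ∧ (t.Sol k → s.Sol k)

lemma Valid.smaller_of_size {k : ℤ} {s t : Net U} (ht : t.Valid k) (hV : t.V = s.V)
    (hl : t.low = s.low) (h : t.size < s.size) : t.Smaller s := by
  have := ht.size_nonneg
  exact Or.inr ⟨by rw [hV], Or.inr ⟨by rw [hV, hl], by omega⟩⟩

lemma deg_erase {N : Finset U} {w : U → U → ℤ} {a z : U} (h : w a z = 0) :
    deg (N.erase z) w a = deg N w a := by
  by_cases hz : z ∈ N
  · rw [deg, deg, ← Finset.add_sum_erase N _ hz, h, zero_add]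
  · rw [Finset.erase_eq_of_notMem hz]

lemma Valid.remove_isolated {k : ℤ} {s : Net U} (h : s.Valid k) {z : U} (hz : z ∈ s.Z)
    (hd : deg s.N s.w z = 0) : Reducible k s := by
  have hzN : z ∈ s.N := mem_N.2 (Or.inr hz)
  have hzV : z ∉ s.V := fun h' => Finset.disjoint_left.1 h.disj h' hz
  have hw : ∀ b ∈ s.N, s.w z b = 0 := fun b hb =>
    le_antisymm (hd ▸ h.le_deg z hb) (h.nonneg _ _)
  have hw' : ∀ b ∈ s.N, s.w b z = 0 := fun b hb => by rw [h.symm, hw b hb]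
  have hg : s.g z = 0 := le_antisymm (hd ▸ h.z_le z hz) (h.ghost z)
  have hr : s.r z = 0 := by have := h.z_abs z hz; rw [hg] at this; exact abs_nonpos_iff.1 this
  let t : Net U := { s with Z := s.Z.erase z }
  have hN : t.N = s.N.erase z := by
    ext a; by_cases ha : a = z <;> simp [t, N, ha, hzV]
  have hsub : t.N ⊆ s.N := hN ▸ Finset.erase_subset _ _
  have hdeg : ∀ a ∈ s.N, deg t.N s.w a = deg s.N s.w a := fun a ha => by
    rw [hN, deg_erase (hw' a ha)]
  have hF : ∀ X ⊆ t.N, t.F X = s.F X := by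
    intro X hX
    simp only [F, cut, t]
    congr 1
    refine Finset.sum_congr rfl fun a ha => ?_
    have : t.N \ X = (s.N \ X).erase z := by rw [hN]; ext b; simp; tauto
    change ∑ b ∈ t.N \ X, s.w a b = _
    rw [this]
    exact deg_erase (hw' a (hsub (hX ha)))
  have ht : t.Valid k := by
    refine ⟨h.disj.mono_right (Finset.erase_subset _ _), h.nonempty, h.symm, h.nonneg, h.diag,
      h.ghost, ?_, ?_, ?_, ?_, ?_, ?_, ?_, h.v_abs, h.low_pos, h.low_neg, ?_, ?_⟩
    · exact fun a ha b hb => h.zz a (Finset.mem_of_mem_erase ha) b (Finset.mem_of_mem_erase hb)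
    · intro a ha
      have := h.parity a (hsub ha)
      rwa [← hdeg a (hsub ha)] at this
    · have := h.sum
      rw [← Finset.add_sum_erase _ _ hzN, hr, zero_add, ← hN] at this
      exact this
    · have := h.ghost_sum
      rw [← Finset.add_sum_erase _ _ hzN, hg, zero_add, ← hN] at this
      exact this
    · exact fun a ha => h.z_abs a (Finset.mem_of_mem_erase ha)
    · intro a ha
      have ha := Finset.mem_of_mem_erase ha
      have := h.z_le a ha
      rwa [← hdeg a (mem_N.2 (Or.inr ha))] at this
    · intro a ha
      have ha := Finset.mem_of_mem_erase ha
      have := h.z_even a ha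
      rwa [← hdeg a (mem_N.2 (Or.inr ha))] at this
    · intro X hX
      rw [hF X hX]
      exact h.single X (hX.trans hsub)
    · intro X hX
      rw [hF X hX]
      exact h.multi X (hX.trans hsub)
  refine ⟨t, ht, ht.smaller_of_size rfl rfl ?_, ?_⟩
  · have h2 : t.size + 1 = s.size := by
      have e1 : ∑ a ∈ s.N, deg s.N s.w a = ∑ a ∈ t.N, deg t.N t.w a := by
        rw [← Finset.add_sum_erase _ _ hzN, hd, zero_add, ← hN]
        exact Finset.sum_congr rfl fun a ha => (hdeg a (hsub ha)).symm
      have e2 := Finset.card_erase_add_one hz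
      rw [size, size, e1]
      simp only [t]
      rw [← e2]; push_cast; ring
    omega
  · rintro ⟨ν, h1, h2, h3, h4⟩
    have hνd : ∀ a ≠ z, deg s.N (fun a b => if a = z ∨ b = z then 0 else ν a b) a = deg t.N ν a := by
      intro a ha
      rw [hN, ← deg_erase (z := z) (by simp)]
      exact Finset.sum_congr rfl fun b hb => by simp [ha, Finset.ne_of_mem_erase hb]
    refine ⟨fun a b => if a = z ∨ b = z then 0 else ν a b, ?_, ?_, ?_, ?_⟩
    · intro a b
      simp only [or_comm (a := b = z)]
      split_ifs
      · simp
      · exact h1 a b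
    · intro a ha b hb
      by_cases hab : a = z ∨ b = z
      · simp only [hab, if_true]
        rcases hab with rfl | rfl
        · simp [hw b hb]
        · simp [hw' a ha]
      · simp only [hab, if_false]
        push Not at hab
        exact h2 a (hN ▸ Finset.mem_erase.2 ⟨hab.1, ha⟩) b (hN ▸ Finset.mem_erase.2 ⟨hab.2, hb⟩)
    · intro a ha
      rw [hνd a (fun e => hzV (e ▸ ha))]
      exact h3 a ha
    · intro a ha
      by_cases haz : a = z
      · subst haz; simp [deg, hr]
      · rw [hνd a haz]
        exact h4 a (Finset.mem_erase.2 ⟨haz, ha⟩)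

lemma cut_link {s : Net U} {c d : U} (hc : c ∈ s.N) (hd : d ∈ s.N) (t : Net U) (hV : t.V = s.V)
    (hZ : t.Z = s.Z) {n : ℤ} (hw : t.w = fun u v => s.w u v + n * link c d u v) (X : Finset U) :
    cut t.N t.w X = cut s.N s.w X + n * (if (c ∈ X ↔ d ∈ X) then 0 else 1) := by
  have hN : t.N = s.N := by simp [N, hV, hZ]
  rw [hN, hw, cut_add_link s.w n hc hd]

lemma Valid.trim {k : ℤ} {s : Net U} (h : s.Valid k) {z y : U} (hz : z ∈ s.Z) (hy : y ∈ s.V)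
    (hw : deg s.N s.w z + s.g z < 2 * s.w z y) : Reducible k s := by
  have hzN : z ∈ s.N := mem_N.2 (Or.inr hz)
  have hyN : y ∈ s.N := mem_N.2 (Or.inl hy)
  have hzV : z ∉ s.V := fun h' => Finset.disjoint_left.1 h.disj h' hz
  have hyZ : y ∉ s.Z := fun h' => Finset.disjoint_left.1 h.disj hy h'
  have hzy : z ≠ y := fun e => hzV (e ▸ hy)
  have hev := h.z_even z hz
  have hle := h.le_deg z hyN
  have hgz := h.ghost z
  let t : Net U := { s with w := fun u v => s.w u v + (-2) * link z y u v }
  have hdeg : ∀ u, deg t.N t.w u =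
      deg s.N s.w u + (-2) * ((if u = z then 1 else 0) + if u = y then 1 else 0) :=
    deg_add_link s.w (-2) hzN hyN
  have hdz : deg t.N t.w z = deg s.N s.w z - 2 := by rw [hdeg]; simp [hzy]; ring
  have hdn : ∀ u ∈ s.Z, u ≠ z → deg t.N t.w u = deg s.N s.w u := by
    intro u hu huz
    rw [hdeg]; simp [huz, show u ≠ y from fun e => hyZ (e ▸ hu)]
  have hF : ∀ X ⊆ s.N, ∃ Y ⊆ s.N, Y ∩ s.V = X ∩ s.V ∧ s.F Y ≤ t.F X := by
    intro X hX
    have hFX : t.F X = s.F X + (-2) * (if (z ∈ X ↔ y ∈ X) then 0 else 1) := by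
      simp only [F]
      rw [cut_link hzN hyN t rfl rfl rfl]; simp only [t]; ring
    by_cases hzX : z ∈ X <;> by_cases hyX : y ∈ X
    · exact ⟨X, hX, rfl, by rw [hFX]; simp [hzX, hyX]⟩
    · refine ⟨X.erase z, (Finset.erase_subset _ _).trans hX, ?_, ?_⟩
      · ext a; simp; rintro - h1 rfl; exact hzV h1
      · have h1 := h.F_erase hX hzX
        have h2 : ∑ b ∈ X.erase z, s.w z b + s.w z y ≤ deg s.N s.w z := by
          rw [add_comm, ← Finset.sum_insert (s := X.erase z) (a := y) (by simp [hyX])]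
          refine Finset.sum_le_sum_of_subset_of_nonneg ?_ fun _ _ _ => h.nonneg _ _
          intro a ha
          rcases Finset.mem_insert.1 ha with rfl | ha
          · exact hyN
          · exact hX (Finset.mem_of_mem_erase ha)
        rw [hFX]; simp only [hzX, hyX]; norm_num
        omega
    · refine ⟨insert z X, Finset.insert_subset hzN hX, ?_, ?_⟩
      · ext a; simp; rintro h1 rfl; exact absurd h1 hzV
      · have h1 := h.F_insert hX hzN hzX
        have h2 : s.w z y ≤ ∑ b ∈ X, s.w z b :=
          Finset.single_le_sum (f := s.w z) (fun b _ => h.nonneg z b) hyX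
        rw [hFX]; simp only [hzX, hyX]; norm_num
        omega
    · exact ⟨X, hX, rfl, by rw [hFX]; simp [hzX, hyX]⟩
  have ht : t.Valid k := by
    refine ⟨h.disj, h.nonempty, ?_, ?_, ?_, h.ghost, ?_, ?_, h.sum, h.ghost_sum, h.z_abs, ?_, ?_,
      h.v_abs, h.low_pos, h.low_neg, ?_, ?_⟩
    · intro a b; simp only [t]; rw [h.symm, link_comm]
    · exact nonneg_sub_link h.symm h.nonneg hzy (by omega)
    · intro a; simp only [t]; rw [h.diag, link_self hzy]; rfl
    · intro a ha b hb
      simp only [t]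
      rw [h.zz a ha b hb, link_eq_zero]
      · rfl
      · rintro ⟨-, rfl⟩; exact hyZ hb
      · rintro ⟨rfl, -⟩; exact hyZ ha
    · intro a ha
      have := h.parity a ha
      rw [hdeg]
      simp only [t]
      omega
    · intro a ha
      by_cases haz : a = z
      · subst haz; rw [hdz]; simp only [t]; omega
      · rw [hdn a ha haz]; exact h.z_le a ha
    · intro a ha
      by_cases haz : a = z
      · subst haz; rw [hdz]; simp only [t]; omega
      · rw [hdn a ha haz]; exact h.z_even a ha
    · intro X hX x hXx hx
      obtain ⟨Y, hY, hYX, hFY⟩ := hF X hX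
      have := h.single Y hY x (hYX.trans hXx) hx
      exact ⟨this.1.trans hFY, this.2.trans (add_le_add_left hFY _)⟩
    · intro X hX h1 h2
      obtain ⟨Y, hY, hYX, hFY⟩ := hF X hX
      exact (h.multi Y hY (hYX ▸ h1) (hYX ▸ h2)).trans hFY
  refine ⟨t, ht, ht.smaller_of_size rfl rfl ?_, ?_⟩
  · have h2 : t.size = s.size + 2 * (-2) := by
      simp only [size]
      rw [add_assoc, ← sum_deg_add_link s.w (-2) hzN hyN]; rfl
    omega
  · rintro ⟨ν, h1, h2, h3, h4⟩
    refine ⟨ν, h1, ?_, h3, h4⟩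
    intro a ha b hb
    obtain ⟨h5, h6⟩ := h2 a ha b hb
    have := link_nonneg z y a b
    simp only [t] at h5 h6
    exact ⟨by linarith, by omega⟩

/-- A single vertex `y` of `V` together with nodes of `Z`, one of which is `z`. -/
lemma Valid.F_single_erase {k : ℤ} {s : Net U} (h : s.Valid k) {X : Finset U} (hX : X ⊆ s.N)
    {y z : U} (hz : z ∈ s.Z) (hzX : z ∈ X) (hXy : X ∩ s.V = {y}) :
    (X.erase z) ∩ s.V = {y} ∧
      s.F X = s.F (X.erase z) + (deg s.N s.w z + s.g z) - 2 * s.w z y := by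
  have hzV : z ∉ s.V := fun h' => Finset.disjoint_left.1 h.disj h' hz
  have h1 : (X.erase z) ∩ s.V = {y} := by
    rw [← hXy]; ext a; simp; rintro - h1 rfl; exact hzV h1
  refine ⟨h1, ?_⟩
  rw [h.F_erase hX hzX, h.sum_Z ((Finset.erase_subset _ _).trans hX) hz, h1,
    Finset.sum_singleton]

lemma Valid.absorb {k : ℤ} (hk : 2 ≤ k) {s : Net U} (h : s.Valid k) (hs : s.Slack k) {z u : U}
    (hz : z ∈ s.Z) (hu : u ∈ s.V) (hg : 1 ≤ s.g z) (hw : 1 ≤ s.w z u)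
    (hmax : ∀ y ∈ s.V, s.w z y ≤ s.w z u) : Reducible k s := by
  have hzN : z ∈ s.N := mem_N.2 (Or.inr hz)
  have huN : u ∈ s.N := mem_N.2 (Or.inl hu)
  have hzV : z ∉ s.V := fun h' => Finset.disjoint_left.1 h.disj h' hz
  have huZ : u ∉ s.Z := fun h' => Finset.disjoint_left.1 h.disj hu h'
  have hzu : z ≠ u := fun e => hzV (e ▸ hu)
  have hev := h.z_even z hz
  have hpz := h.parity z hzN
  have hgz := h.z_le z hz
  obtain ⟨φ, hφ, hφz⟩ : ∃ φ : ℤ, (φ = 1 ∨ φ = -1) ∧ |s.r z - φ| ≤ s.g z - 1 := by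
    have := h.z_abs z hz
    rw [abs_le] at this
    rcases le_or_gt 1 (s.r z) with h1 | h1
    · exact ⟨1, Or.inl rfl, by rw [abs_le]; omega⟩
    · exact ⟨-1, Or.inr rfl, by rw [abs_le]; omega⟩
  let t : Net U := { s with
    w := fun a b => s.w a b + (-1) * link z u a b
    g := fun a => s.g a + ((if a = u then 1 else 0) - if a = z then 1 else 0)
    r := fun a => s.r a - φ * ((if a = z then 1 else 0) - if a = u then 1 else 0) }
  have hdeg : ∀ a, deg t.N t.w a =
      deg s.N s.w a + (-1) * ((if a = z then 1 else 0) + if a = u then 1 else 0) :=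
    deg_add_link s.w (-1) hzN huN
  have hdz : deg t.N t.w z = deg s.N s.w z - 1 := by rw [hdeg]; simp [hzu]; ring
  have hdn : ∀ a ∈ s.Z, a ≠ z → deg t.N t.w a = deg s.N s.w a := by
    intro a ha haz
    rw [hdeg]; simp [haz, show a ≠ u from fun e => huZ (e ▸ ha)]
  have hgz' : t.g z = s.g z - 1 := by simp [t, hzu]; ring
  have hgu : t.g u = s.g u + 1 := by simp [t, hzu.symm]
  have hgn : ∀ a, a ≠ z → a ≠ u → t.g a = s.g a := fun a h1 h2 => by simp [t, h1, h2]
  have hrz : t.r z = s.r z - φ := by simp [t, hzu]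
  have hru : t.r u = s.r u + φ := by simp [t, hzu.symm]
  have hrn : ∀ a, a ≠ z → a ≠ u → t.r a = s.r a := fun a h1 h2 => by simp [t, h1, h2]
  have hgsum : ∀ X : Finset U, ∑ a ∈ X, t.g a = ∑ a ∈ X, s.g a +
      ((if u ∈ X then 1 else 0) - if z ∈ X then 1 else 0) := by
    intro X
    simp [t, Finset.sum_add_distrib]
  have hF : ∀ X ⊆ s.N, t.F X = s.F X + ((if u ∈ X then 1 else 0) - if z ∈ X then 1 else 0) -
      (if (z ∈ X ↔ u ∈ X) then 0 else 1) := by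
    intro X hX
    simp only [F]
    rw [cut_link hzN huN t rfl rfl rfl, hgsum]; ring
  have hF0 : ∀ X ⊆ s.N, (z ∉ X ∨ u ∈ X) → t.F X = s.F X := by
    intro X hX h1
    rw [hF X hX]
    by_cases h2 : z ∈ X <;> by_cases h3 : u ∈ X <;> simp_all
  have hF2 : ∀ X ⊆ s.N, s.F X ≤ t.F X + 2 := by
    intro X hX
    rw [hF X hX]
    split_ifs <;> omega
  have ht : t.Valid k := by
    refine ⟨h.disj, h.nonempty, ?_, ?_, ?_, ?_, ?_, ?_, ?_, ?_, ?_, ?_, ?_, ?_, ?_, ?_, ?_, ?_⟩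
    · intro a b; simp only [t]; rw [h.symm, link_comm]
    · exact nonneg_sub_link h.symm h.nonneg hzu hw
    · intro a; simp only [t]; rw [h.diag, link_self hzu]; rfl
    · intro a
      have := h.ghost a
      by_cases haz : a = z
      · subst haz; omega
      by_cases hau : a = u
      · subst hau; omega
      rw [hgn a haz hau]; exact this
    · intro a ha b hb
      simp only [t]
      rw [h.zz a ha b hb, link_eq_zero]
      · rfl
      · rintro ⟨-, rfl⟩; exact huZ hb
      · rintro ⟨rfl, -⟩; exact huZ ha
    · intro a ha
      have := h.parity a ha
      by_cases haz : a = z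
      · subst haz; rw [hdz, hrz]; omega
      by_cases hau : a = u
      · subst hau; rw [hdeg, hru]; simp [haz]; omega
      rw [hdeg, hrn a haz hau]; simpa [haz, hau] using this
    · have : ∑ a ∈ t.N, t.r a = ∑ a ∈ s.N, s.r a := by
        change ∑ a ∈ s.N, t.r a = _
        simp [t, Finset.sum_sub_distrib, ← Finset.mul_sum, hzN, huN]
      rw [this]; exact h.sum
    · change ∑ a ∈ s.N, t.g a ≤ _
      rw [hgsum]; simp only [huN, hzN, if_true]; linarith [h.ghost_sum]
    · intro a ha
      by_cases haz : a = z
      · subst haz; rw [hrz, hgz']; exact hφz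
      rw [hrn a haz (fun e => huZ (e ▸ ha)), hgn a haz (fun e => huZ (e ▸ ha))]
      exact h.z_abs a ha
    · intro a ha
      by_cases haz : a = z
      · subst haz; rw [hdz, hgz']; omega
      rw [hdn a ha haz, hgn a haz (fun e => huZ (e ▸ ha))]; exact h.z_le a ha
    · intro a ha
      by_cases haz : a = z
      · subst haz; rw [hdz, hgz']; omega
      rw [hdn a ha haz, hgn a haz (fun e => huZ (e ▸ ha))]; exact h.z_even a ha
    · intro a ha
      have := h.v_abs a ha
      have haz : a ≠ z := fun e => hzV (e ▸ ha)
      by_cases hau : a = u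
      · subst hau; rw [hru, hgu]; rw [abs_le] at *; omega
      rw [hrn a haz hau, hgn a haz hau]; exact this
    · have key : ∀ a ∈ s.V, t.g a < t.r a → s.g a < s.r a := by
        intro a ha h1
        have haz : a ≠ z := fun e => hzV (e ▸ ha)
        by_cases hau : a = u
        · subst hau; rw [hru, hgu] at h1; omega
        rwa [hrn a haz hau, hgn a haz hau] at h1
      intro x hx y hy hxl hyl hxy ⟨h1, h2⟩
      exact h.low_pos x hx y hy hxl hyl hxy ⟨key x hx h1, key y hy h2⟩
    · have key : ∀ a ∈ s.V, t.r a < - t.g a → s.r a < - s.g a := by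
        intro a ha h1
        have haz : a ≠ z := fun e => hzV (e ▸ ha)
        by_cases hau : a = u
        · subst hau; rw [hru, hgu] at h1; omega
        rwa [hrn a haz hau, hgn a haz hau] at h1
      intro x hx y hy hxl hyl hxy ⟨h1, h2⟩
      exact h.low_neg x hx y hy hxl hyl hxy ⟨key x hx h1, key y hy h2⟩
    · intro X hX y hXy hVy
      have hyX : y ∈ X ∩ s.V := by rw [show X ∩ s.V = {y} from hXy]; simp
      have hyV := (Finset.mem_inter.1 hyX).2
      have hyz : y ≠ z := fun e => hzV (e ▸ hyV)
      have hc : t.c k y = s.c k y := rfl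
      rw [hc]
      by_cases hzX : z ∈ X ∧ u ∉ X
      · have hyu : y ≠ u := fun e => hzX.2 (e ▸ (Finset.mem_inter.1 hyX).1)
        obtain ⟨h1, h2⟩ := h.F_single_erase hX hz hzX.1 hXy
        have h3 := h.single _ ((Finset.erase_subset z X).trans hX) y h1 hVy
        have h4 := hF2 X hX
        have h5 : s.w z y + s.w z u ≤ deg s.N s.w z := by
          rw [h.deg_Z hz, ← Finset.sum_pair hyu]
          exact Finset.sum_le_sum_of_subset_of_nonneg
            (by intro a ha; simp at ha; rcases ha with rfl | rfl <;> assumption)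
            fun _ _ _ => h.nonneg _ _
        have h6 := hmax y hyV
        rw [hrn y hyz hyu, hgn y hyz hyu]
        constructor <;> omega
      · rw [hF0 X hX (by tauto)]
        have h3 := h.single X hX y hXy hVy
        by_cases hyu : y = u
        · subst hyu; rw [hru, hgu]
          refine ⟨h3.1, ?_⟩
          have : |s.r y + φ| ≤ |s.r y| + 1 := by
            refine (abs_add_le _ _).trans ?_
            rcases hφ with rfl | rfl <;> simp
          linarith [h3.2]
        · rwa [hrn y hyz hyu, hgn y hyz hyu]
    · intro X hX h1 h2
      have := hs X hX h1 h2
      have := hF2 X hX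
      omega
  refine ⟨t, ht, ht.smaller_of_size rfl rfl ?_, ?_⟩
  · have h2 : t.size = s.size + 2 * (-1) := by
      simp only [size]
      rw [add_assoc, ← sum_deg_add_link s.w (-1) hzN huN]; rfl
    omega
  · exact Sol.of_link hzu hzN huN rfl rfl rfl hφ fun _ => rfl

lemma link_triangle {a b z : U} (hab : a ≠ b) (haz : a ≠ z) (hzb : z ≠ b) (u v : U) :
    (link a z u v = 1 ∧ link z b u v = 0 ∧ link a b u v = 0 ∧
      (arc a z u v = 1 ∧ arc z b u v = 0 ∧ arc a b u v = 0 ∨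
        arc a z u v = -1 ∧ arc z b u v = 0 ∧ arc a b u v = 0)) ∨
    (link a z u v = 0 ∧ link z b u v = 1 ∧ link a b u v = 0 ∧
      (arc a z u v = 0 ∧ arc z b u v = 1 ∧ arc a b u v = 0 ∨
        arc a z u v = 0 ∧ arc z b u v = -1 ∧ arc a b u v = 0)) ∨
    (link a z u v = 0 ∧ link z b u v = 0 ∧ link a b u v = 1 ∧
      (arc a z u v = 0 ∧ arc z b u v = 0 ∧ arc a b u v = 1 ∧ u = a ∧ v = b ∨
        arc a z u v = 0 ∧ arc z b u v = 0 ∧ arc a b u v = -1 ∧ u = b ∧ v = a)) ∨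
    (link a z u v = 0 ∧ link z b u v = 0 ∧ link a b u v = 0 ∧
      arc a z u v = 0 ∧ arc z b u v = 0 ∧ arc a b u v = 0) := by
  unfold link arc
  have := hab.symm
  have := haz.symm
  have := hzb.symm
  by_cases h1 : u = a
  · subst h1
    by_cases h2 : v = b
    · subst h2; simp [*]
    · by_cases h3 : v = z <;> simp [*]
  · by_cases h4 : u = b
    · subst h4
      by_cases h2 : v = a
      · subst h2; simp [*]
      · by_cases h3 : v = z <;> simp [*]
    · by_cases h5 : u = z
      · subst h5
        by_cases h2 : v = a
        · subst h2; simp [*]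
        · by_cases h3 : v = b <;> simp [*]
      · simp [*]

/-- The deviation from `ν` when the flow on `ab` is rerouted through `z`. -/
lemma split_bound {w ν : ℤ} (h : |ν| ≤ w + 1) (hp : 2 ∣ w + 1 - ν) (hw : 0 ≤ w) :
    ∃ φ : ℤ, (φ = 1 ∨ φ = -1) ∧ |ν - φ| ≤ w := by
  rw [abs_le] at h
  rcases le_or_gt 1 ν with h1 | h1
  · exact ⟨1, Or.inl rfl, by rw [abs_le]; omega⟩
  · exact ⟨-1, Or.inr rfl, by rw [abs_le]; omega⟩

lemma Valid.split {k : ℤ} (hk : 2 ≤ k) {s : Net U} (h : s.Valid k) (hs : s.Slack k) {z a b : U}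
    (hz : z ∈ s.Z) (ha : a ∈ s.V) (hb : b ∈ s.V) (hab : a ≠ b) (hg : s.g z = 0)
    (hwa : 1 ≤ s.w z a) (hwb : 1 ≤ s.w z b) (hmaxa : ∀ y ∈ s.V, s.w z y ≤ s.w z a)
    (hmax : ∀ y ∈ s.V, y ≠ a → s.w z y ≤ s.w z b) : Reducible k s := by
  have hzN : z ∈ s.N := mem_N.2 (Or.inr hz)
  have haN : a ∈ s.N := mem_N.2 (Or.inl ha)
  have hbN : b ∈ s.N := mem_N.2 (Or.inl hb)
  have hzV : z ∉ s.V := fun h' => Finset.disjoint_left.1 h.disj h' hz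
  have haZ : a ∉ s.Z := fun h' => Finset.disjoint_left.1 h.disj ha h'
  have hbZ : b ∉ s.Z := fun h' => Finset.disjoint_left.1 h.disj hb h'
  have haz : a ≠ z := fun e => hzV (e ▸ ha)
  have hzb : z ≠ b := fun e => hzV (e ▸ hb)
  have hev := h.z_even z hz
  let w1 : U → U → ℤ := fun u v => s.w u v + (-1) * link a z u v
  let w2 : U → U → ℤ := fun u v => w1 u v + (-1) * link z b u v
  let t : Net U := { s with w := fun u v => w2 u v + 1 * link a b u v }
  have hdeg : ∀ u, deg t.N t.w u = deg s.N s.w u - if u = z then 2 else 0 := by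
    intro u
    refine (deg_add_link w2 1 haN hbN u).trans ?_
    rw [deg_add_link w1 (-1) hzN hbN u, deg_add_link s.w (-1) haN hzN u]
    by_cases h1 : u = z
    · subst h1; simp [haz.symm, hzb]; ring
    · simp only [h1, if_false]; ring
  have hdz : deg t.N t.w z = deg s.N s.w z - 2 := by rw [hdeg]; simp
  have hdn : ∀ u, u ≠ z → deg t.N t.w u = deg s.N s.w u := by
    intro u hu
    rw [hdeg]; simp [hu]
  have hwz : ∀ u v, t.w u v = s.w u v - link a z u v - link z b u v + link a b u v := by
    intro u v; simp only [t, w2, w1]; ring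
  have h3w : ∀ y ∈ s.V, y ≠ a → y ≠ b → s.w z y + s.w z a + s.w z b ≤ deg s.N s.w z := by
    intro y hy hya hyb
    rw [h.deg_Z hz, add_assoc, ← Finset.sum_pair hab, ← Finset.sum_insert (by simp [hya, hyb])]
    exact Finset.sum_le_sum_of_subset_of_nonneg
      (by intro x hx; simp at hx; rcases hx with rfl | rfl | rfl <;> assumption)
      fun _ _ _ => h.nonneg _ _
  have h2w : s.w z a + s.w z b ≤ deg s.N s.w z := by
    rw [h.deg_Z hz, ← Finset.sum_pair hab]
    exact Finset.sum_le_sum_of_subset_of_nonneg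
      (by intro x hx; simp at hx; rcases hx with rfl | rfl <;> assumption)
      fun _ _ _ => h.nonneg _ _
  have hF : ∀ X ⊆ s.N, t.F X = s.F X - (if (a ∈ X ↔ z ∈ X) then 0 else 1) -
      (if (z ∈ X ↔ b ∈ X) then 0 else 1) + (if (a ∈ X ↔ b ∈ X) then 0 else 1) := by
    intro X hX
    simp only [F]
    have : cut t.N t.w X = _ := cut_add_link w2 1 haN hbN
    have e : cut t.N w2 X = _ := cut_add_link w1 (-1) hzN hbN
    have e' : cut t.N w1 X = cut s.N s.w X + _ := cut_add_link s.w (-1) haN hzN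
    rw [this, e, e']
    simp only [t]; ring
  have hF0 : ∀ X ⊆ s.N, (a ∈ X ∨ b ∈ X ∨ z ∉ X) → ¬ (a ∈ X ∧ b ∈ X ∧ z ∉ X) →
      t.F X = s.F X := by
    intro X hX h1 h1'
    rw [hF X hX]
    by_cases h2 : z ∈ X <;> by_cases h3 : a ∈ X <;> by_cases h4 : b ∈ X <;> simp_all
  have hF2 : ∀ X ⊆ s.N, s.F X ≤ t.F X + 2 := by
    intro X hX
    rw [hF X hX]
    split_ifs <;> omega
  have hsy : ∀ u v, t.w u v = t.w v u := by
    intro u v; rw [hwz, hwz, h.symm, link_comm a z, link_comm z b, link_comm a b]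
  have hnn : ∀ u v, 0 ≤ t.w u v := by
    intro u v
    rw [hwz]
    have h0 := link_nonneg a b u v
    have h1 := h.nonneg u v
    rcases link_cases haz u v with ⟨rfl, rfl, e1, -⟩ | ⟨rfl, rfl, e1, -⟩ | ⟨-, -, e1, -⟩
    · rw [link_eq_zero (a := v) (b := b) (by simp [haz]) (by simp [hab])]
      rw [h.symm] at hwa; linarith
    · rw [link_eq_zero (a := u) (b := b) (by simp [hab]) (by simp [hzb])]
      linarith
    · rcases link_cases hzb u v with ⟨rfl, rfl, e2, -⟩ | ⟨rfl, rfl, e2, -⟩ | ⟨-, -, e2, -⟩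
      · linarith
      · rw [h.symm] at hwb; linarith
      · linarith
  have ht : t.Valid k := by
    refine ⟨h.disj, h.nonempty, hsy, hnn, ?_, h.ghost, ?_, ?_, h.sum, h.ghost_sum, h.z_abs, ?_, ?_,
      h.v_abs, h.low_pos, h.low_neg, ?_, ?_⟩
    · intro u; rw [hwz, h.diag, link_self haz, link_self hzb, link_self hab]; rfl
    · intro u hu v hv
      rw [hwz, h.zz u hu v hv, link_eq_zero, link_eq_zero, link_eq_zero]
      · rfl
      all_goals rintro ⟨rfl, rfl⟩
      all_goals first | exact haZ hu | exact haZ hv | exact hbZ hu | exact hbZ hv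
    · intro u hu
      have := h.parity u hu
      rw [hdeg]
      simp only [t]
      split_ifs <;> omega
    · intro u hu
      by_cases huz : u = z
      · subst huz; rw [hdz]; simp only [t]; omega
      · rw [hdn u huz]; exact h.z_le u hu
    · intro u hu
      by_cases huz : u = z
      · subst huz; rw [hdz]; simp only [t]; omega
      · rw [hdn u huz]; exact h.z_even u hu
    · intro X hX y hXy hVy
      have hyX : y ∈ X ∩ s.V := by rw [show X ∩ s.V = {y} from hXy]; simp
      have hyV := (Finset.mem_inter.1 hyX).2
      have hc : t.c k y = s.c k y := rfl
      have hnot : ¬ (a ∈ X ∧ b ∈ X) := by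
        rintro ⟨h1, h2⟩
        have h3 : a ∈ X ∩ s.V := Finset.mem_inter.2 ⟨h1, ha⟩
        have h4 : b ∈ X ∩ s.V := Finset.mem_inter.2 ⟨h2, hb⟩
        rw [show X ∩ s.V = {y} from hXy, Finset.mem_singleton] at h3 h4
        exact hab (h3.trans h4.symm)
      rw [hc]
      by_cases hzX : z ∈ X ∧ a ∉ X ∧ b ∉ X
      · have hya : y ≠ a := fun e => hzX.2.1 (e ▸ (Finset.mem_inter.1 hyX).1)
        have hyb : y ≠ b := fun e => hzX.2.2 (e ▸ (Finset.mem_inter.1 hyX).1)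
        obtain ⟨h1, h2⟩ := h.F_single_erase hX hz hzX.1 hXy
        have h3 := h.single _ ((Finset.erase_subset z X).trans hX) y h1 hVy
        have h4 := hF2 X hX
        have h5 := h3w y hyV hya hyb
        have h6 := hmax y hyV hya
        have h7 := hmaxa b hb
        simp only [t] at h4 ⊢
        constructor <;> omega
      · rw [hF0 X hX (by tauto) (by tauto)]
        exact h.single X hX y hXy hVy
    · intro X hX h1 h2
      have := hs X hX h1 h2
      have := hF2 X hX
      omega
  refine ⟨t, ht, ht.smaller_of_size rfl rfl ?_, ?_⟩
  · have h2 : ∑ u ∈ t.N, deg t.N t.w u = ∑ u ∈ s.N, deg s.N s.w u - 2 := by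
      change ∑ u ∈ s.N, deg t.N t.w u = _
      simp only [hdeg, Finset.sum_sub_distrib, Finset.sum_ite_eq', hzN, if_true]
    simp only [size]; rw [h2]; simp only [t]; omega
  · rintro ⟨ν, h1, h2, h3, h4⟩
    have hq := h2 a haN b hbN
    have hwab : t.w a b = s.w a b + 1 := by
      rw [hwz, link_eq_one hab, link_eq_zero (a := a) (b := z) (by simp [hzb.symm]) (by simp [haz]),
        link_eq_zero (a := z) (b := b) (by simp [haz]) (by simp [hab])]; ring
    rw [hwab] at hq
    obtain ⟨φ, hφ, hφν⟩ := split_bound hq.1 hq.2 (h.nonneg a b)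
    let ν1 : U → U → ℤ := fun u v => ν u v + φ * arc a z u v
    let ν2 : U → U → ℤ := fun u v => ν1 u v + φ * arc z b u v
    have hdν : ∀ u, deg s.N (fun u v => ν2 u v + (-φ) * arc a b u v) u = deg s.N ν u := by
      intro u
      rw [deg_add_arc ν2 (-φ) haN hbN, deg_add_arc ν1 φ hzN hbN, deg_add_arc ν φ haN hzN]
      ring
    refine ⟨fun u v => ν2 u v + (-φ) * arc a b u v, ?_, ?_, ?_, ?_⟩
    · intro u v
      simp only [ν2, ν1]
      rw [h1 u v, arc_comm a z, arc_comm z b, arc_comm a b]; ring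
    · intro u hu v hv
      obtain ⟨h5, h6⟩ := h2 u hu v hv
      rw [hwz] at h5 h6
      simp only [ν2, ν1]
      have hba : |ν b a + φ| ≤ s.w b a := by
        rw [h1 b a, h.symm b a, ← abs_neg]; convert hφν using 2; ring
      rw [abs_le] at h5 hφν hba ⊢
      have hne : b ≠ z := hzb.symm
      rcases link_triangle hab haz hzb u v with
        ⟨e1, e2, e3, ⟨e1', e2', e3'⟩ | ⟨e1', e2', e3'⟩⟩ |
        ⟨e1, e2, e3, ⟨e1', e2', e3'⟩ | ⟨e1', e2', e3'⟩⟩ |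
        ⟨e1, e2, e3, ⟨e1', e2', e3', rfl, rfl⟩ | ⟨e1', e2', e3', rfl, rfl⟩⟩ |
        ⟨e1, e2, e3, e1', e2', e3'⟩ <;>
      rw [e1, e2, e3] at h5 h6 <;> rw [e1', e2', e3'] <;> rcases hφ with rfl | rfl <;> omega
    · intro u hu
      rw [hdν]; exact h3 u hu
    · intro u hu
      rw [hdν]; exact h4 u hu

lemma Valid.reduce_exact {k : ℤ} (hk : 2 ≤ k) {s : Net U} (h : s.Valid k) (hs : s.Slack k) {z : U}
    (hz : z ∈ s.Z) : Reducible k s := by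
  by_cases hd : deg s.N s.w z = 0
  · exact h.remove_isolated hz hd
  by_cases htr : ∃ y ∈ s.V, deg s.N s.w z + s.g z < 2 * s.w z y
  · obtain ⟨y, hy, hw⟩ := htr
    exact h.trim hz hy hw
  push Not at htr
  have hd' : 0 < deg s.N s.w z := lt_of_le_of_ne (h.deg_nonneg z) (Ne.symm hd)
  obtain ⟨a, ha, hmax⟩ := s.V.exists_max_image (s.w z) h.nonempty
  have hsum := h.deg_Z hz
  have hpos : ∀ T : Finset U, 0 < ∑ b ∈ T, s.w z b → ∃ b ∈ T, 0 < s.w z b :=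
    fun T hT => Finset.exists_lt_of_sum_lt (f := fun _ => (0 : ℤ)) (by simpa using hT)
  have hwa : 1 ≤ s.w z a := by
    obtain ⟨b, hb, hb'⟩ := hpos s.V (hsum ▸ hd')
    have := hmax b hb
    omega
  rcases le_or_gt 1 (s.g z) with hg | hg
  · exact h.absorb hk hs hz ha hg hwa hmax
  have hg : s.g z = 0 := by have := h.ghost z; omega
  have hpos' : 0 < ∑ b ∈ s.V.erase a, s.w z b := by
    have := Finset.add_sum_erase s.V (s.w z) ha
    have := htr a ha
    omega
  obtain ⟨c, hc, -⟩ := hpos _ hpos'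
  obtain ⟨b, hb, hbmax⟩ := (s.V.erase a).exists_max_image (s.w z) ⟨c, hc⟩
  obtain ⟨c, hc, hc'⟩ := hpos _ hpos'
  have hcb := hbmax c hc
  exact h.split hk hs hz ha (Finset.mem_of_mem_erase hb) (Finset.ne_of_mem_erase hb).symm hg hwa
    (by omega) hmax fun y hy hya => hbmax y (Finset.mem_erase.2 ⟨hya, hy⟩)

/-- If all nodes but one of `V` form `X`, the cut of `X` is the degree of the last node. -/
lemma Valid.F_compl {k : ℤ} {s : Net U} (h : s.Valid k) {y : U} (hy : y ∈ s.N) :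
    s.F (s.N.erase y) = deg s.N s.w y + ∑ a ∈ s.N.erase y, s.g a := by
  have : s.N \ s.N.erase y = {y} := by ext a; simp; constructor <;> simp_all
  rw [F, cut, this, deg, ← Finset.add_sum_erase _ _ hy, h.diag]
  simp [h.symm _ y]

lemma Valid.reduce_neutral {k : ℤ} (hk : 2 ≤ k) {s : Net U} (h : s.Valid k) (hs : s.Slack k)
    (hZ : s.Z = ∅) (hV : 3 ≤ s.V.card) {y : U} (hy : y ∈ s.V) (hr : |s.r y| ≤ s.g y) :
    Reducible k s := by
  have hN : s.N = s.V := by simp [N, hZ]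
  have hyN : y ∈ s.N := hN ▸ hy
  obtain ⟨γ, hγ0, hγr, hγg, hγg', hγe⟩ : ∃ γ : ℤ, 0 ≤ γ ∧ |s.r y| ≤ γ ∧ γ ≤ s.g y ∧
      s.g y ≤ γ + 1 ∧ 2 ∣ deg s.N s.w y + γ := by
    have h1 := h.parity y hyN
    have h2 := h.ghost y
    by_cases he : 2 ∣ deg s.N s.w y + s.g y
    · exact ⟨s.g y, h2, hr, le_rfl, by omega, he⟩
    · rw [abs_le] at hr
      exact ⟨s.g y - 1, by omega, by rw [abs_le]; omega, by omega, by omega, by omega⟩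
  let t : Net U := { s with V := s.V.erase y, Z := {y}, g := Function.update s.g y γ }
  have htN : t.N = s.N := by
    rw [hN]; simp only [N, t]; ext a; by_cases hay : a = y <;> simp [hay, hy]
  have hgy : t.g y = γ := by simp [t]
  have hgn : ∀ a, a ≠ y → t.g a = s.g a := fun a ha => by simp [t, ha]
  have hgle : ∀ a, t.g a ≤ s.g a := by
    intro a
    by_cases ha : a = y
    · subst ha; rw [hgy]; exact hγg
    · rw [hgn a ha]
  have hgsum : ∀ X : Finset U, ∑ a ∈ X, t.g a ≤ ∑ a ∈ X, s.g a ∧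
      ∑ a ∈ X, s.g a ≤ ∑ a ∈ X, t.g a + 1 := by
    intro X
    refine ⟨Finset.sum_le_sum fun a _ => hgle a, ?_⟩
    by_cases hX : y ∈ X
    · rw [← Finset.add_sum_erase _ _ hX, ← Finset.add_sum_erase X t.g hX,
        Finset.sum_congr rfl fun a ha => hgn a (Finset.ne_of_mem_erase ha), hgy]
      linarith
    · rw [Finset.sum_congr rfl fun a ha => hgn a (fun e => hX (e ▸ ha))]; linarith
  have hcut : ∀ X, t.F X = s.F X + (∑ a ∈ X, t.g a - ∑ a ∈ X, s.g a) := by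
    intro X; simp only [F]; rw [htN]; ring
  have hF1 : ∀ X, s.F X ≤ t.F X + 1 := by
    intro X; rw [hcut]; have := (hgsum X).2; omega
  have hF0 : ∀ X, y ∉ X → t.F X = s.F X := by
    intro X hX
    rw [hcut, Finset.sum_congr rfl fun a ha => hgn a (fun e => hX (e ▸ ha))]; ring
  have hdy : s.g y < deg s.N s.w y := by
    have h1 := hs (s.N.erase y) (Finset.erase_subset _ _)
    rw [h.F_compl hyN] at h1
    have h2 := h.ghost_sum
    rw [← Finset.add_sum_erase _ _ hyN] at h2
    have h3 : s.N.erase y ∩ s.V = s.V.erase y := by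
      rw [hN]; exact Finset.inter_eq_left.2 (Finset.erase_subset _ _)
    rw [h3] at h1
    have := h1 (by rw [Finset.card_erase_of_mem hy]; omega) (Finset.erase_ssubset hy).ne
    linarith
  have hsub : ∀ {X}, X ⊆ t.N → X ⊆ s.N := fun hX => htN ▸ hX
  have htV : ∀ X ⊆ s.N, X ∩ t.V = X.erase y := by
    intro X hX
    ext a
    simp only [t, Finset.mem_inter, Finset.mem_erase]
    have := @hX a
    rw [hN] at this
    tauto
  have hsV : ∀ X ⊆ s.N, X ∩ s.V = X := fun X hX => Finset.inter_eq_left.2 (hN ▸ hX)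
  have ht : t.Valid k := by
    refine ⟨by simp [t], ?_, h.symm, h.nonneg, h.diag, ?_, ?_, ?_, ?_, ?_, ?_, ?_, ?_, ?_,
      ?_, ?_, ?_, ?_⟩
    · apply Finset.card_pos.1
      simp only [t]; rw [Finset.card_erase_of_mem hy]; omega
    · intro a
      by_cases ha : a = y
      · subst ha; rw [hgy]; exact hγ0
      · rw [hgn a ha]; exact h.ghost a
    · intro a ha b hb
      simp only [t, Finset.mem_singleton] at ha hb
      subst ha hb; exact h.diag _
    · rw [htN]; exact h.parity
    · rw [htN]; exact h.sum
    · rw [htN]; exact (hgsum _).1.trans h.ghost_sum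
    · intro a ha
      simp only [t, Finset.mem_singleton] at ha
      subst ha; rw [hgy]; exact hγr
    · intro a ha
      simp only [t, Finset.mem_singleton] at ha
      subst ha; rw [hgy, htN]; exact hγg.trans hdy.le
    · intro a ha
      simp only [t, Finset.mem_singleton] at ha
      subst ha; rw [hgy, htN]; exact hγe
    · intro a ha
      simp only [t, Finset.mem_erase] at ha
      rw [hgn a ha.1]; exact h.v_abs a ha.2
    · intro a ha b hb
      simp only [t, Finset.mem_erase] at ha hb
      rw [hgn a ha.1, hgn b hb.1]; exact h.low_pos a ha.2 b hb.2
    · intro a ha b hb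
      simp only [t, Finset.mem_erase] at ha hb
      rw [hgn a ha.1, hgn b hb.1]; exact h.low_neg a ha.2 b hb.2
    · intro X hX u hXu hVu
      have hX := hsub hX
      rw [htV X hX] at hXu
      have hu : u ∈ X.erase y := by rw [hXu]; simp
      have huy := Finset.ne_of_mem_erase hu
      have huV : u ∈ s.V := hN ▸ hX (Finset.mem_of_mem_erase hu)
      have hc : t.c k u = s.c k u := rfl
      rw [hc, hgn u huy]
      by_cases hyX : y ∈ X
      · have hcard : X.card = 2 := by
          rw [← Finset.card_erase_add_one hyX, hXu]; simp
        have h1 := hs X hX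
        rw [hsV X hX] at h1
        have h2 := h1 (by omega) (fun e => by rw [e] at hcard; omega)
        have h3 := hF1 X
        have h4 := h.v_abs u huV
        have h5 : s.c k u ≤ 9 * k := by unfold c; split_ifs <;> omega
        simp only [t] at h3 ⊢
        constructor <;> omega
      · rw [hF0 X hyX]
        rw [Finset.erase_eq_of_notMem hyX] at hXu
        exact h.single X hX u (by rw [hsV X hX, hXu]) (fun e => by rw [e] at hV; simp at hV)
    · intro X hX h1 h2
      have hX := hsub hX
      rw [htV X hX] at h1 h2
      have h3 := hF1 X
      have h4 := hs X hX
      rw [hsV X hX] at h4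
      have h5 := h4 (h1.trans (Finset.card_le_card (Finset.erase_subset _ _)))
        (fun e => h2 (by simp only [t]; rw [e]))
      omega
  refine ⟨t, ht, Or.inl ?_, ?_⟩
  · simp only [t]; exact Finset.card_erase_lt_of_mem hy
  · rintro ⟨ν, h1, h2, h3, h4⟩
    rw [htN] at h2 h3 h4
    refine ⟨ν, h1, h2, ?_, by simp [hZ]⟩
    intro a ha
    by_cases hay : a = y
    · subst hay
      rw [h4 a (by simp [t])]; simp [t]
    · exact h3 a (Finset.mem_erase.2 ⟨hay, ha⟩)

lemma Valid.reduce_edge {k : ℤ} (hk : 2 ≤ k) {s : Net U} (h : s.Valid k) (hs : s.Slack k)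
    {y u : U} (hy : y ∈ s.V) (hu : u ∈ s.V) (hry : s.g y < s.r y) (hru : s.r u < - s.g u)
    (hw : 1 ≤ s.w y u) : Reducible k s := by
  have hyN : y ∈ s.N := mem_N.2 (Or.inl hy)
  have huN : u ∈ s.N := mem_N.2 (Or.inl hu)
  have hyZ : y ∉ s.Z := fun h' => Finset.disjoint_left.1 h.disj hy h'
  have huZ : u ∉ s.Z := fun h' => Finset.disjoint_left.1 h.disj hu h'
  have hgy := h.ghost y
  have hgu := h.ghost u
  have hyu : y ≠ u := by rintro rfl; omega
  let t : Net U := { s with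
    w := fun a b => s.w a b + (-1) * link y u a b
    r := fun a => s.r a - 1 * ((if a = y then 1 else 0) - if a = u then 1 else 0) }
  have hdeg : ∀ a, deg t.N t.w a =
      deg s.N s.w a + (-1) * ((if a = y then 1 else 0) + if a = u then 1 else 0) :=
    deg_add_link s.w (-1) hyN huN
  have hdn : ∀ a, a ≠ y → a ≠ u → deg t.N t.w a = deg s.N s.w a := by
    intro a ha ha'
    rw [hdeg]; simp [ha, ha']
  have hty : t.r y = s.r y - 1 := by simp [t, hyu]
  have htu : t.r u = s.r u + 1 := by simp [t, hyu.symm]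
  have htn : ∀ a, a ≠ y → a ≠ u → t.r a = s.r a := fun a h1 h2 => by simp [t, h1, h2]
  have hF : ∀ X ⊆ s.N, t.F X = s.F X - (if (y ∈ X ↔ u ∈ X) then 0 else 1) := by
    intro X hX
    simp only [F]
    rw [cut_link hyN huN t rfl rfl rfl]; simp only [t]; ring
  have hF1 : ∀ X ⊆ s.N, s.F X ≤ t.F X + 1 := by
    intro X hX
    rw [hF X hX]; split_ifs <;> omega
  have hrabs : ∀ a, |t.r a| ≤ |s.r a| := by
    intro a
    by_cases h1 : a = y
    · subst h1; rw [hty, abs_of_nonneg (by omega), abs_of_nonneg (by omega)]; omega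
    by_cases h2 : a = u
    · subst h2; rw [htu, abs_of_nonpos (by omega), abs_of_nonpos (by omega)]; omega
    rw [htn a h1 h2]
  have hrabs' : ∀ a, a = y ∨ a = u → |t.r a| + 1 ≤ |s.r a| ∧ s.g a + 1 ≤ |s.r a| := by
    rintro a (h1 | h2)
    · subst h1; rw [hty, abs_of_nonneg (by omega), abs_of_nonneg (by omega)]; omega
    · subst h2; rw [htu, abs_of_nonpos (by omega), abs_of_nonpos (by omega)]; omega
  have ht : t.Valid k := by
    refine ⟨h.disj, h.nonempty, ?_, ?_, ?_, h.ghost, ?_, ?_, ?_, h.ghost_sum, ?_, ?_, ?_, ?_, ?_,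
      ?_, ?_, ?_⟩
    · intro a b; simp only [t]; rw [h.symm, link_comm]
    · exact nonneg_sub_link h.symm h.nonneg hyu hw
    · intro a; simp only [t]; rw [h.diag, link_self hyu]; rfl
    · intro a ha b hb
      simp only [t]
      rw [h.zz a ha b hb, link_eq_zero]
      · rfl
      · rintro ⟨rfl, -⟩; exact hyZ ha
      · rintro ⟨-, rfl⟩; exact hyZ hb
    · intro a ha
      have := h.parity a ha
      by_cases h1 : a = y
      · subst h1; rw [hdeg, hty]; simp [hyu]; omega
      by_cases h2 : a = u
      · subst h2; rw [hdeg, htu]; simp [h1]; omega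
      rw [hdn a h1 h2, htn a h1 h2]; exact this
    · have : ∑ a ∈ t.N, t.r a = ∑ a ∈ s.N, s.r a := by
        change ∑ a ∈ s.N, t.r a = _
        simp [t, Finset.sum_sub_distrib, hyN, huN]
      rw [this]; exact h.sum
    · intro a ha; exact (hrabs a).trans (h.z_abs a ha)
    · intro a ha
      rw [hdn a (fun e => hyZ (e ▸ ha)) (fun e => huZ (e ▸ ha))]; exact h.z_le a ha
    · intro a ha
      rw [hdn a (fun e => hyZ (e ▸ ha)) (fun e => huZ (e ▸ ha))]; exact h.z_even a ha
    · intro a ha; exact (hrabs a).trans (h.v_abs a ha)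
    · have key : ∀ a, s.g a < t.r a → s.g a < s.r a := by
        intro a h0
        by_cases h1 : a = y
        · subst h1; omega
        by_cases h2 : a = u
        · subst h2; omega
        rwa [htn a h1 h2] at h0
      intro a ha b hb hal hbl hab ⟨h1, h2⟩
      exact h.low_pos a ha b hb hal hbl hab ⟨key a h1, key b h2⟩
    · have key : ∀ a, t.r a < - s.g a → s.r a < - s.g a := by
        intro a h0
        by_cases h1 : a = y
        · subst h1; omega
        by_cases h2 : a = u
        · subst h2; omega
        rwa [htn a h1 h2] at h0
      intro a ha b hb hal hbl hab ⟨h1, h2⟩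
      exact h.low_neg a ha b hb hal hbl hab ⟨key a h1, key b h2⟩
    · intro X hX x hXx hVx
      have hc : t.c k x = s.c k x := rfl
      rw [hc]
      have h3 := h.single X hX x hXx hVx
      by_cases hx : x = y ∨ x = u
      · have h1 := hF1 X hX
        have h2 := hrabs' x hx
        simp only [t] at h1 h2 ⊢
        constructor <;> omega
      · push Not at hx
        have hn : ∀ a ∈ s.V, a ≠ x → a ∉ X := by
          intro a ha hax haX
          have : a ∈ X ∩ s.V := Finset.mem_inter.2 ⟨haX, ha⟩
          rw [show X ∩ s.V = {x} from hXx, Finset.mem_singleton] at this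
          exact hax this
        rw [hF X hX, htn x hx.1 hx.2]
        simpa [hn y hy hx.1.symm, hn u hu hx.2.symm] using h3
    · intro X hX h1 h2
      have := hs X hX h1 h2
      have := hF1 X hX
      omega
  refine ⟨t, ht, ht.smaller_of_size rfl rfl ?_, ?_⟩
  · have h2 : t.size = s.size + 2 * (-1) := by
      simp only [size]
      rw [add_assoc, ← sum_deg_add_link s.w (-1) hyN huN]; rfl
    omega
  · exact Sol.of_link hyu hyN huN rfl rfl rfl (Or.inl rfl) fun _ => rfl

/-- Lowering a vertex `y` by changing its target to a congruent one. -/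
lemma Valid.reduce_flip {k : ℤ} (hk : 2 ≤ k) {s : Net U} (h : s.Valid k)
    {y : U} (hy : y ∈ s.V) (hyl : y ∉ s.low) {ρ : ℤ} (hρ : |ρ| ≤ 2 * k) (hρr : 2 * k ∣ ρ - s.r y)
    (hpos : s.g y < ρ → ∀ x ∈ s.V, x ≠ y → ¬ s.g x < s.r x)
    (hneg : ρ < - s.g y → ∀ x ∈ s.V, x ≠ y → ¬ s.r x < - s.g x) : Reducible k s := by
  have hyN : y ∈ s.N := mem_N.2 (Or.inl hy)
  have hyZ : y ∉ s.Z := fun h' => Finset.disjoint_left.1 h.disj hy h'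
  let t : Net U := { s with low := insert y s.low, r := Function.update s.r y ρ }
  have hty : t.r y = ρ := by simp [t]
  have htn : ∀ a, a ≠ y → t.r a = s.r a := fun a h1 => by simp [t, h1]
  have hcong : ∀ a, 2 * k ∣ t.r a - s.r a := by
    intro a
    by_cases ha : a = y
    · subst ha; rwa [hty]
    · simp [htn a ha]
  have hcong2 : ∀ a, (2 : ℤ) ∣ t.r a - s.r a := fun a => (dvd_mul_right 2 k).trans (hcong a)
  have ht : t.Valid k := by
    refine ⟨h.disj, h.nonempty, h.symm, h.nonneg, h.diag, h.ghost, h.zz, ?_, ?_, h.ghost_sum, ?_,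
      h.z_le, h.z_even, ?_, ?_, ?_, ?_, h.multi⟩
    · intro a ha
      have h1 := hcong2 a
      have h2 := h.parity a ha
      change 2 ∣ deg s.N s.w a - t.r a
      omega
    · change 2 * k ∣ ∑ a ∈ s.N, t.r a
      have : ∑ a ∈ s.N, t.r a = ∑ a ∈ s.N, (t.r a - s.r a) + ∑ a ∈ s.N, s.r a := by
        rw [← Finset.sum_add_distrib]; simp
      rw [this]
      exact dvd_add (Finset.dvd_sum fun a _ => hcong a) h.sum
    · intro a ha
      rw [htn a fun e => hyZ (e ▸ ha)]; exact h.z_abs a ha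
    · intro a ha
      by_cases hay : a = y
      · subst hay; rw [hty]; have := h.ghost a; simp only [t]; omega
      · rw [htn a hay]; exact h.v_abs a ha
    · intro a ha b hb hal hbl hab ⟨h1, h2⟩
      simp only [t, Finset.mem_insert] at hal hbl
      by_cases hay : a = y
      · subst hay
        rw [hty] at h1; rw [htn b hab.symm] at h2
        exact hpos h1 b hb hab.symm h2
      by_cases hby : b = y
      · subst hby
        rw [hty] at h2; rw [htn a hab] at h1
        exact hpos h2 a ha hab h1
      rw [htn a hay] at h1; rw [htn b hby] at h2
      exact h.low_pos a ha b hb (by tauto) (by tauto) hab ⟨h1, h2⟩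
    · intro a ha b hb hal hbl hab ⟨h1, h2⟩
      simp only [t, Finset.mem_insert] at hal hbl
      by_cases hay : a = y
      · subst hay
        rw [hty] at h1; rw [htn b hab.symm] at h2
        exact hneg h1 b hb hab.symm h2
      by_cases hby : b = y
      · subst hby
        rw [hty] at h2; rw [htn a hab] at h1
        exact hneg h2 a ha hab h1
      rw [htn a hay] at h1; rw [htn b hby] at h2
      exact h.low_neg a ha b hb (by tauto) (by tauto) hab ⟨h1, h2⟩
    · intro X hX x hXx hVx
      have h3 := h.single X hX x hXx hVx
      change t.c k x ≤ s.F X ∧ t.c k x + |t.r x| ≤ s.F X + s.g x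
      by_cases hxy : x = y
      · subst hxy
        have h1 : t.c k x = 7 * k := by simp [c, t]
        have h2 : s.c k x = 9 * k := by simp [c, hyl]
        have h4 := h.ghost x
        rw [hty, h1]; rw [h2] at h3
        constructor <;> omega
      · have h1 : t.c k x = s.c k x := by simp [c, t, hxy]
        rw [h1, htn x hxy]; exact h3
  refine ⟨t, ht, Or.inr ⟨rfl, Or.inl ?_⟩, ?_⟩
  · apply Finset.card_lt_card
    refine Finset.ssubset_iff_of_subset ?_ |>.2 ⟨y, by simp [hy, hyl], by simp [t]⟩
    intro a; simp only [t, Finset.mem_sdiff, Finset.mem_insert]; tauto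
  · rintro ⟨ν, h1, h2, h3, h4⟩
    refine ⟨ν, h1, h2, ?_, ?_⟩
    · intro a ha
      have e : deg s.N ν a - s.r a = (deg s.N ν a - t.r a) + (t.r a - s.r a) := by ring
      rw [e]
      exact dvd_add (h3 a ha) (hcong a)
    · intro a ha
      refine (h4 a ha).trans (htn a fun e => hyZ (e ▸ ha))

lemma exists_centered {k : ℤ} (hk : 2 ≤ k) (n : ℤ) : ∃ ρ, |ρ| ≤ k ∧ 2 * k ∣ ρ - n := by
  have h1 := Int.emod_nonneg n (b := 2 * k) (by omega)
  have h2 := Int.emod_lt_of_pos n (b := 2 * k) (by omega)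
  have h3 : 2 * k ∣ n % (2 * k) - n := by
    rw [← dvd_neg, neg_sub]; exact Int.dvd_self_sub_emod
  rcases le_or_gt (n % (2 * k)) k with h | h
  · exact ⟨_, by rw [abs_le]; omega, h3⟩
  · refine ⟨n % (2 * k) - 2 * k, by rw [abs_le]; omega, ?_⟩
    rw [sub_right_comm]; exact dvd_sub h3 dvd_rfl

lemma Valid.sol_of_card_one {k : ℤ} {s : Net U} (h : s.Valid k) (hZ : s.Z = ∅)
    (hV : s.V.card = 1) : s.Sol k := by
  have hN : s.N = s.V := by simp [N, hZ]
  obtain ⟨x, hx⟩ := Finset.card_eq_one.1 hV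
  refine ⟨fun _ _ => 0, by simp, ?_, ?_, by simp [hZ]⟩
  · intro a ha b hb
    rw [hN, hx, Finset.mem_singleton] at ha hb
    subst ha hb
    simp [h.diag]
  · intro a ha
    have := h.sum
    rw [hN, hx, Finset.sum_singleton] at this
    rw [hx, Finset.mem_singleton] at ha
    subst ha
    simpa [deg] using this

lemma Valid.sol_of_card_two {k : ℤ} (hk : 2 ≤ k) {s : Net U} (h : s.Valid k) (hZ : s.Z = ∅)
    (hV : s.V.card = 2) : s.Sol k := by
  have hN : s.N = s.V := by simp [N, hZ]
  obtain ⟨x, y, hxy, hVxy⟩ := Finset.card_eq_two.1 hV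
  have hNxy := hN.trans hVxy
  have hc : ∀ a, 7 * k ≤ s.c k a := by intro a; unfold c; split_ifs <;> omega
  have hdx : deg s.N s.w x = s.w x y := by
    rw [deg, hNxy, Finset.sum_pair hxy, h.diag, zero_add]
  have hdy : deg s.N s.w y = s.w x y := by
    rw [deg, hNxy, Finset.sum_pair hxy, h.diag, add_zero, h.symm]
  have hsing : ∀ a ∈ s.V, 7 * k ≤ deg s.N s.w a + s.g a := by
    intro a ha
    have h1 := (h.single {a} (by simpa [hN] using ha) a
      (Finset.inter_eq_left.2 (by simpa using ha))
      (fun e => by rw [e] at hV; simp at hV)).1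
    rw [F, cut_singleton h.diag (hN ▸ ha), Finset.sum_singleton] at h1
    exact (hc a).trans h1
  have h1 := hsing x (by simp [hVxy])
  have h2 := hsing y (by simp [hVxy])
  have h3 := h.ghost_sum
  rw [hNxy, Finset.sum_pair hxy] at h3
  have h4 := h.parity x (by simp [hNxy])
  have h5 := h.sum
  rw [hNxy, Finset.sum_pair hxy] at h5
  rw [hdx] at h1 h4
  rw [hdy] at h2
  obtain ⟨ρ, hρ, hρr⟩ := exists_centered hk (s.r x)
  have hρ2 : 2 ∣ ρ - s.r x := (dvd_mul_right 2 k).trans hρr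
  have hdeg : ∀ u, deg s.N (fun u v => 0 + ρ * arc x y u v) u =
      deg s.N (fun _ _ => 0) u + ρ * ((if u = x then 1 else 0) - if u = y then 1 else 0) :=
    fun u => deg_add_arc (fun _ _ => 0) ρ (by simp [hNxy]) (by simp [hNxy]) u
  refine ⟨fun u v => 0 + ρ * arc x y u v, ?_, ?_, ?_, by simp [hZ]⟩
  · intro a b; simp only; rw [arc_comm]; ring
  · intro a ha b hb
    rw [hNxy] at ha hb
    simp only [Finset.mem_insert, Finset.mem_singleton] at ha hb
    rw [abs_le] at hρ
    have h6 := h.symm x y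
    rcases ha with rfl | rfl <;> rcases hb with rfl | rfl
    · simp [arc, hxy, h.diag]
    · simp only [arc, hxy]; simp; rw [abs_le]; omega
    · simp only [arc, hxy.symm]; simp; rw [abs_le]; omega
    · simp [arc, hxy.symm, h.diag]
  · intro a ha
    rw [hdeg]
    rw [hVxy] at ha
    simp only [Finset.mem_insert, Finset.mem_singleton] at ha
    rcases ha with rfl | rfl
    · simpa [deg, hxy] using hρr
    · have : -ρ - s.r a = -(ρ - s.r x) - (s.r x + s.r a) := by ring
      simpa [deg, hxy.symm, this] using dvd_sub ((dvd_neg).2 hρr) h5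

/-- With slack in all nontrivial cuts, a valid net is solved or reduced. -/
lemma Valid.sol_or_reducible {k : ℤ} (hk : 2 ≤ k) {s : Net U} (h : s.Valid k) (hs : s.Slack k) :
    s.Sol k ∨ Reducible k s := by
  by_cases hZ : s.Z = ∅
  swap
  · obtain ⟨z, hz⟩ := Finset.nonempty_iff_ne_empty.2 hZ
    exact Or.inr (h.reduce_exact hk hs hz)
  have hN : s.N = s.V := by simp [N, hZ]
  have hpos := h.nonempty.card_pos
  by_cases hV1 : s.V.card = 1
  · exact Or.inl (h.sol_of_card_one hZ hV1)
  by_cases hV2 : s.V.card = 2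
  · exact Or.inl (h.sol_of_card_two hk hZ hV2)
  have hV : 3 ≤ s.V.card := by omega
  right
  by_cases hneu : ∃ y ∈ s.V, |s.r y| ≤ s.g y
  · obtain ⟨y, hy, hr⟩ := hneu
    exact h.reduce_neutral hk hs hZ hV hy hr
  have hpn : ∀ y ∈ s.V, s.g y < s.r y ∨ s.r y < - s.g y := by
    intro y hy
    by_contra hcon
    push Not at hcon
    exact hneu ⟨y, hy, abs_le.2 ⟨hcon.2, hcon.1⟩⟩
  by_cases hed : ∃ y ∈ s.V, ∃ u ∈ s.V, s.g y < s.r y ∧ s.r u < - s.g u ∧ 1 ≤ s.w y u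
  · obtain ⟨y, hy, u, hu, h1, h2, h3⟩ := hed
    exact h.reduce_edge hk hs hy hu h1 h2 h3
  let P := s.V.filter fun y => s.g y < s.r y
  let M := s.V.filter fun y => ¬ s.g y < s.r y
  have hmem : ∀ y ∈ M, y ∈ s.V ∧ s.r y < - s.g y := by
    intro y hy
    have := Finset.mem_filter.1 hy
    exact ⟨this.1, (hpn y this.1).resolve_left this.2⟩
  have hPM : ∀ y ∈ P, ∀ u ∈ M, s.w y u = 0 := by
    intro y hy u hu
    have h1 := Finset.mem_filter.1 hy
    have h2 := hmem u hu
    by_contra hne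
    have := h.nonneg y u
    exact hed ⟨y, h1.1, u, h2.1, h1.2, h2.2, by omega⟩
  have hcard : P.card + M.card = s.V.card := Finset.card_filter_add_card_filter_not _
  have hlowcard : ∀ Q : Finset U, (∀ x ∈ Q, ∀ y ∈ Q, x ∈ s.low → y ∈ s.low → x = y) →
      3 ≤ Q.card → ∃ y ∈ Q, y ∉ s.low := by
    intro Q hQ hQc
    by_contra hcon
    push Not at hcon
    have : Q.card ≤ 1 := Finset.card_le_one.2 fun a ha b hb => hQ a ha b hb (hcon a ha) (hcon b hb)
    omega
  have hmod1 := fun n : ℤ => Int.emod_nonneg n (b := 2 * k) (by omega)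
  have hmod2 := fun n : ℤ => Int.emod_lt_of_pos n (b := 2 * k) (by omega)
  have hmod3 : ∀ n : ℤ, 2 * k ∣ n % (2 * k) - n := by
    intro n; rw [← dvd_neg, neg_sub]; exact Int.dvd_self_sub_emod
  by_cases hM : M = ∅
  · have hall : ∀ y ∈ s.V, s.g y < s.r y := by
      intro y hy
      by_contra hcon
      have hyM : y ∈ M := Finset.mem_filter.2 ⟨hy, hcon⟩
      rw [hM] at hyM
      exact Finset.notMem_empty y hyM
    obtain ⟨y, hy, hyl⟩ := hlowcard s.V (fun a ha b hb hal hbl => by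
      by_contra hab
      exact h.low_pos a ha b hb hal hbl hab ⟨hall a ha, hall b hb⟩) hV
    have h1 := hmod1 (s.r y)
    have h2 := hmod2 (s.r y)
    have h3 := h.ghost y
    refine h.reduce_flip hk hy hyl (ρ := s.r y % (2 * k) - 2 * k) (by rw [abs_le]; omega) ?_
      (fun h' => by omega) ?_
    · rw [sub_right_comm]; exact dvd_sub (hmod3 _) dvd_rfl
    · intro _ x hx _ h'
      have := hall x hx
      have := h.ghost x
      omega
  by_cases hP : P = ∅
  · have hall : ∀ y ∈ s.V, s.r y < - s.g y := by
      intro y hy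
      refine (hpn y hy).resolve_left fun hcon => ?_
      have hyP : y ∈ P := Finset.mem_filter.2 ⟨hy, hcon⟩
      rw [hP] at hyP
      exact Finset.notMem_empty y hyP
    obtain ⟨y, hy, hyl⟩ := hlowcard s.V (fun a ha b hb hal hbl => by
      by_contra hab
      exact h.low_neg a ha b hb hal hbl hab ⟨hall a ha, hall b hb⟩) hV
    have h1 := hmod1 (s.r y)
    have h2 := hmod2 (s.r y)
    have h3 := h.ghost y
    refine h.reduce_flip hk hy hyl (ρ := s.r y % (2 * k)) (by rw [abs_le]; omega) (hmod3 _)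
      ?_ (fun h' => by omega)
    intro _ x hx _ h'
    have := hall x hx
    have := h.ghost x
    omega
  exfalso
  have hP0 := Finset.card_pos.2 (Finset.nonempty_iff_ne_empty.2 hP)
  have hM0 := Finset.card_pos.2 (Finset.nonempty_iff_ne_empty.2 hM)
  have hPV : P ⊆ s.V := Finset.filter_subset _ _
  have hMV : M ⊆ s.V := Finset.filter_subset _ _
  have hdP : s.V \ P = M := by ext a; simp [P, M]; tauto
  have hdM : s.V \ M = P := by ext a; simp [P, M]; tauto
  have hgle : ∀ X ⊆ s.V, ∑ a ∈ X, s.g a ≤ 12 * k := fun X hX =>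
    (Finset.sum_le_sum_of_subset_of_nonneg (hN ▸ hX) fun a _ _ => h.ghost a).trans h.ghost_sum
  rcases le_or_gt 2 P.card with h2 | h2
  · have h3 := hs P (hN ▸ hPV)
    rw [Finset.inter_eq_left.2 hPV] at h3
    have h4 := h3 h2 fun e => by rw [e] at hcard; omega
    rw [F, cut, hN, hdP, Finset.sum_eq_zero fun a ha => Finset.sum_eq_zero fun b hb =>
      hPM a ha b hb] at h4
    have := hgle P hPV
    linarith
  · have h3 := hs M (hN ▸ hMV)
    rw [Finset.inter_eq_left.2 hMV] at h3
    have h4 := h3 (by omega) fun e => by rw [e] at hcard; omega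
    rw [F, cut, hN, hdM, Finset.sum_eq_zero fun a ha => Finset.sum_eq_zero fun b hb =>
      (h.symm a b).trans (hPM b hb a ha)] at h4
    have := hgle M hMV
    linarith

end Net

/-- Distributing a total over several bounded summands of prescribed parity. -/
lemma exists_distribution {ι : Type} (X : Finset ι) (w : ι → ℤ)
    (hw : ∀ a ∈ X, 0 ≤ w a) :
    ∀ n : ℤ, |n| ≤ ∑ a ∈ X, w a → 2 ∣ ∑ a ∈ X, w a - n →
      ∃ f : ι → ℤ, ∑ a ∈ X, f a = n ∧ ∀ a ∈ X, |f a| ≤ w a ∧ 2 ∣ w a - f a := by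
  classical
  induction X using Finset.induction_on with
  | empty =>
    intro n hn _
    have hn0 : n = 0 := by simpa using hn
    exact ⟨fun _ => 0, by simp [hn0], by simp⟩
  | insert a X ha ih =>
    intro n hn hp
    rw [Finset.sum_insert ha] at hn hp
    have ih := ih fun b hb => hw b (Finset.mem_insert_of_mem hb)
    have hwa := hw a (Finset.mem_insert_self a X)
    have hW : 0 ≤ ∑ b ∈ X, w b := Finset.sum_nonneg fun b hb => hw b (Finset.mem_insert_of_mem hb)
    obtain ⟨t, ht1, ht2, ht3⟩ : ∃ t, |t| ≤ w a ∧ 2 ∣ w a - t ∧ |n - t| ≤ ∑ b ∈ X, w b := by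
      rw [abs_le] at hn
      by_cases h : w a - ∑ b ∈ X, w b ≤ n
      · exact ⟨w a, by rw [abs_le]; omega, by simp, by rw [abs_le]; omega⟩
      · exact ⟨n + ∑ b ∈ X, w b, by rw [abs_le]; omega, by omega, by rw [abs_le]; omega⟩
    obtain ⟨f, hf1, hf2⟩ := ih (n - t) ht3 (by omega)
    refine ⟨Function.update f a t, ?_, ?_⟩
    · rw [Finset.sum_insert ha, Function.update_self, Finset.sum_update_of_notMem ha, hf1]; ring
    · intro b hb
      rcases eq_or_ne b a with rfl | hba
      · rw [Function.update_self]; exact ⟨ht1, ht2⟩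
      · rw [Function.update_of_ne hba]; exact hf2 b (Finset.mem_of_mem_insert_of_ne hb hba)

lemma two_dvd_cut_sub {N : Finset U} {w : U → U → ℤ} (hs : ∀ a b, w a b = w b a)
    (hd : ∀ a, w a a = 0) (X : Finset U) : X ⊆ N → 2 ∣ cut N w X - ∑ a ∈ X, deg N w a := by
  induction X using Finset.induction_on with
  | empty => simp [cut]
  | insert a X ha ih =>
    intro h
    have h1 := ih ((Finset.subset_insert a X).trans h)
    rw [cut_insert hs hd ((Finset.subset_insert a X).trans h) (h (Finset.mem_insert_self a X)) ha,
      Finset.sum_insert ha]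
    omega

namespace Net

/-- Contracting `X` to the single vertex `x`, with new target `ρ`. -/
def contract (s : Net U) (X : Finset U) (x : U) (ρ : ℤ) : Net U where
  V := insert x (s.V \ X)
  Z := s.Z \ X
  low := s.low.erase x
  w a b := if a = x then (if b = x then 0 else ∑ u ∈ X, s.w u b)
    else if b = x then ∑ u ∈ X, s.w a u else s.w a b
  g := Function.update s.g x (∑ u ∈ X, s.g u)
  r := Function.update s.r x ρ

/-- Restricting to `X`, the edges leaving `X` becoming ghosts that carry the flow `η`. -/
def restrict (s : Net U) (X : Finset U) (η : U → U → ℤ) : Net U where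
  V := s.V ∩ X
  Z := s.Z ∩ X
  low := s.low
  w := s.w
  g a := s.g a + ∑ b ∈ s.N \ X, s.w a b
  r a := s.r a - ∑ b ∈ s.N \ X, η a b

section contract
variable {s : Net U} {X : Finset U} {x : U} {ρ : ℤ}

lemma contract_N (s : Net U) (X : Finset U) (x : U) (ρ : ℤ) :
    (s.contract X x ρ).N = insert x (s.N \ X) := by
  ext a; simp [N, contract]; tauto

lemma contract_w_of_ne {a b : U} (ha : a ≠ x) (hb : b ≠ x) :
    (s.contract X x ρ).w a b = s.w a b := by simp [contract, ha, hb]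

lemma contract_w_left {b : U} (hb : b ≠ x) :
    (s.contract X x ρ).w x b = ∑ u ∈ X, s.w u b := by simp [contract, hb]

lemma contract_w_right {b : U} (hb : b ≠ x) :
    (s.contract X x ρ).w b x = ∑ u ∈ X, s.w b u := by simp [contract, hb]

lemma contract_deg (hX : X ⊆ s.N) (hx : x ∈ X) {a : U} (ha : a ∈ s.N \ X) :
    deg (s.contract X x ρ).N (s.contract X x ρ).w a = deg s.N s.w a := by
  have hne : ∀ b ∈ s.N \ X, b ≠ x := fun b hb h => (Finset.mem_sdiff.1 hb).2 (h ▸ hx)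
  rw [contract_N, deg, Finset.sum_insert (fun h => hne _ h rfl), contract_w_right (hne a ha), deg,
    ← Finset.sum_sdiff hX, add_comm]
  congr 1
  exact Finset.sum_congr rfl fun b hb => contract_w_of_ne (hne a ha) (hne b hb)

lemma contract_deg_self (hx : x ∈ X) :
    deg (s.contract X x ρ).N (s.contract X x ρ).w x = cut s.N s.w X := by
  have hne : ∀ b ∈ s.N \ X, b ≠ x := fun b hb h => (Finset.mem_sdiff.1 hb).2 (h ▸ hx)
  rw [contract_N, deg, Finset.sum_insert (fun h => hne _ h rfl), cut, Finset.sum_comm]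
  simp only [contract, if_true, zero_add]
  exact Finset.sum_congr rfl fun b hb => by rw [if_neg (hne b hb)]

lemma contract_F_of_notMem (hX : X ⊆ s.N) (hx : x ∈ X) {Y : Finset U} (hY : Y ⊆ s.N \ X) :
    (s.contract X x ρ).F Y = s.F Y := by
  have hne : ∀ b ∈ s.N \ X, b ≠ x := fun b hb h => (Finset.mem_sdiff.1 hb).2 (h ▸ hx)
  have h1 : insert x (s.N \ X) \ Y = insert x ((s.N \ X) \ Y) := by
    ext a; simp only [Finset.mem_sdiff, Finset.mem_insert]
    constructor
    · tauto
    · rintro (rfl | h)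
      · exact ⟨Or.inl rfl, fun h => hne _ (hY h) rfl⟩
      · tauto
  have h2 : s.N \ Y = X ∪ ((s.N \ X) \ Y) := by
    ext a
    have h3 := @hX a
    have h4 := @hY a
    simp only [Finset.mem_sdiff, Finset.mem_union] at h4 ⊢
    tauto
  have h3 : Disjoint X ((s.N \ X) \ Y) :=
    Finset.disjoint_sdiff.mono_right Finset.sdiff_subset
  rw [F, F, cut, cut, contract_N, h1, h2]
  congr 1
  · refine Finset.sum_congr rfl fun a ha => ?_
    have ha' := hne a (hY ha)
    rw [Finset.sum_union h3, Finset.sum_insert (fun h => hne x (Finset.sdiff_subset h) rfl),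
      contract_w_right ha']
    congr 1
    exact Finset.sum_congr rfl fun b hb => contract_w_of_ne ha' (hne b (Finset.sdiff_subset hb))
  · exact Finset.sum_congr rfl fun a ha => Function.update_of_ne (hne a (hY ha)) _ _

lemma contract_F_insert (hx : x ∈ X) {Y : Finset U} (hY : Y ⊆ s.N \ X) :
    (s.contract X x ρ).F (insert x Y) = s.F (X ∪ Y) := by
  have hne : ∀ b ∈ s.N \ X, b ≠ x := fun b hb h => (Finset.mem_sdiff.1 hb).2 (h ▸ hx)
  have hxY : x ∉ Y := fun h => hne x (hY h) rfl
  have hXY : Disjoint X Y := Finset.disjoint_sdiff.mono_right hY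
  have h1 : insert x (s.N \ X) \ insert x Y = s.N \ (X ∪ Y) := by
    ext a
    by_cases h : a = x
    · subst h; simp [hx]
    · simp [h]; tauto
  have h2 : s.N \ (X ∪ Y) ⊆ s.N \ X := Finset.sdiff_subset_sdiff subset_rfl Finset.subset_union_left
  rw [F, F, cut, cut, contract_N, h1, Finset.sum_insert hxY, Finset.sum_insert hxY,
    Finset.sum_union hXY, Finset.sum_union hXY]
  congr 1
  · congr 1
    · rw [Finset.sum_comm]
      exact Finset.sum_congr rfl fun b hb => contract_w_left (hne b (h2 hb))
    · exact Finset.sum_congr rfl fun a ha => Finset.sum_congr rfl fun b hb =>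
        contract_w_of_ne (hne a (hY ha)) (hne b (h2 hb))
  · congr 1
    · exact Function.update_self _ _ _
    · exact Finset.sum_congr rfl fun a ha => Function.update_of_ne (hne a (hY ha)) _ _

lemma Valid.contract {k : ℤ} (hk : 2 ≤ k) (h : s.Valid k) (hX : X ⊆ s.N)
    (hX2 : 2 ≤ (X ∩ s.V).card) (hXV : X ∩ s.V ≠ s.V) (hx : x ∈ X) (hxV : x ∈ s.V)
    (hρ : |ρ| ≤ k) (hρr : 2 * k ∣ ρ - ∑ u ∈ X, s.r u) : (s.contract X x ρ).Valid k := by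
  have hne : ∀ b ∈ s.N \ X, b ≠ x := fun b hb h => (Finset.mem_sdiff.1 hb).2 (h ▸ hx)
  have hVN : s.V ⊆ s.N := Finset.subset_union_left
  have hZN : s.Z ⊆ s.N := Finset.subset_union_right
  have hxZ : x ∉ s.Z := Finset.disjoint_left.1 h.disj hxV
  have hZ : ∀ z ∈ (s.contract X x ρ).Z, z ∈ s.Z ∧ z ∈ s.N \ X ∧ z ≠ x := by
    intro z hz
    obtain ⟨h1, h2⟩ := Finset.mem_sdiff.1 (show z ∈ s.Z \ X from hz)
    exact ⟨h1, Finset.mem_sdiff.2 ⟨hZN h1, h2⟩, fun h => h2 (h ▸ hx)⟩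
  have hV : ∀ y ∈ (s.contract X x ρ).V, y ≠ x → y ∈ s.V ∧ y ∈ s.N \ X := by
    intro y hy hyx
    obtain ⟨h1, h2⟩ := Finset.mem_sdiff.1 (Finset.mem_of_mem_insert_of_ne
      (show y ∈ insert x (s.V \ X) from hy) hyx)
    exact ⟨h1, Finset.mem_sdiff.2 ⟨hVN h1, h2⟩⟩
  have hg : ∀ a, a ≠ x → (s.contract X x ρ).g a = s.g a := fun a ha =>
    Function.update_of_ne ha _ _
  have hr : ∀ a, a ≠ x → (s.contract X x ρ).r a = s.r a := fun a ha =>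
    Function.update_of_ne ha _ _
  have hgx : (s.contract X x ρ).g x = ∑ u ∈ X, s.g u := Function.update_self _ _ _
  have hrx : (s.contract X x ρ).r x = ρ := Function.update_self _ _ _
  have hgX : 0 ≤ ∑ u ∈ X, s.g u := Finset.sum_nonneg fun u _ => h.ghost u
  have hxN : x ∉ s.N \ X := fun h' => hne x h' rfl
  have hcases : ∀ Y ⊆ (s.contract X x ρ).N, ∃ Y' ⊆ s.N \ X,
      x ∉ Y ∧ Y = Y' ∧ Y ∩ (s.contract X x ρ).V = Y' ∩ s.V ∧ (s.contract X x ρ).F Y = s.F Y' ∨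
      Y = insert x Y' ∧ Y ∩ (s.contract X x ρ).V = insert x (Y' ∩ s.V) ∧
        (s.contract X x ρ).F Y = s.F (X ∪ Y') := by
    intro Y hY
    rw [contract_N] at hY
    by_cases hxY : x ∈ Y
    · have hY' : Y.erase x ⊆ s.N \ X := fun a ha =>
        Finset.mem_of_mem_insert_of_ne (hY (Finset.mem_of_mem_erase ha)) (Finset.ne_of_mem_erase ha)
      refine ⟨Y.erase x, hY', Or.inr ⟨(Finset.insert_erase hxY).symm, ?_, ?_⟩⟩
      · ext a
        by_cases ha : a = x
        · simp [ha, hxY, Net.contract]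
        · have := @hY' a
          simp [ha, Net.contract] at this ⊢
          tauto
      · conv_lhs => rw [← Finset.insert_erase hxY]
        exact contract_F_insert hx hY'
    · have hY' : Y ⊆ s.N \ X := fun a ha =>
        Finset.mem_of_mem_insert_of_ne (hY ha) (fun h => hxY (h ▸ ha))
      refine ⟨Y, hY', Or.inl ⟨hxY, rfl, ?_, contract_F_of_notMem hX hx hY'⟩⟩
      ext a
      by_cases ha : a = x
      · simp [ha, hxY]
      · have := @hY' a
        simp [ha, Net.contract] at this ⊢
        tauto
  refine ⟨?_, ⟨x, Finset.mem_insert_self _ _⟩, ?_, ?_, ?_, ?_, ?_, ?_, ?_, ?_, ?_, ?_, ?_, ?_, ?_,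
    ?_, ?_, ?_⟩
  · rw [Finset.disjoint_right]
    intro z hz hzV
    obtain ⟨h1, -, h3⟩ := hZ z hz
    exact Finset.disjoint_left.1 h.disj (hV z hzV h3).1 h1
  · intro a b
    by_cases ha : a = x <;> by_cases hb : b = x <;> simp [Net.contract, ha, hb, h.symm]
  · intro a b
    have h1 := Finset.sum_nonneg fun u (_ : u ∈ X) => h.nonneg u b
    have h2 := Finset.sum_nonneg fun u (_ : u ∈ X) => h.nonneg a u
    have h3 := h.nonneg a b
    by_cases ha : a = x <;> by_cases hb : b = x <;> simp [Net.contract, ha, hb] <;> simp_all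
  · intro a
    by_cases ha : a = x <;> simp [Net.contract, ha, h.diag]
  · intro a
    by_cases ha : a = x
    · rw [ha, hgx]; exact hgX
    · rw [hg a ha]; exact h.ghost a
  · intro a ha b hb
    rw [contract_w_of_ne (hZ a ha).2.2 (hZ b hb).2.2]
    exact h.zz a (hZ a ha).1 b (hZ b hb).1
  · intro a ha
    by_cases hax : a = x
    · rw [hax, hrx, contract_deg_self hx]
      have h1 := two_dvd_cut_sub h.symm h.diag X hX
      have h2 : 2 ∣ ρ - ∑ u ∈ X, s.r u := (dvd_mul_right 2 k).trans hρr
      have h3 : 2 ∣ ∑ u ∈ X, (deg s.N s.w u - s.r u) :=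
        Finset.dvd_sum fun u hu => h.parity u (hX hu)
      rw [Finset.sum_sub_distrib] at h3
      omega
    · rw [contract_N] at ha
      have ha' := Finset.mem_of_mem_insert_of_ne ha hax
      rw [contract_deg hX hx ha', hr a hax]
      exact h.parity a (Finset.sdiff_subset ha')
  · rw [contract_N, Finset.sum_insert hxN, hrx, Finset.sum_congr rfl fun a ha => hr a (hne a ha)]
    have := h.sum
    rw [← Finset.sum_sdiff hX] at this
    have e : ρ + ∑ a ∈ s.N \ X, s.r a =
        (ρ - ∑ u ∈ X, s.r u) + (∑ a ∈ s.N \ X, s.r a + ∑ u ∈ X, s.r u) := by ring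
    rw [e]
    exact dvd_add hρr this
  · rw [contract_N, Finset.sum_insert hxN, hgx, Finset.sum_congr rfl fun a ha => hg a (hne a ha),
      add_comm, Finset.sum_sdiff hX]
    exact h.ghost_sum
  · intro z hz
    obtain ⟨h1, h2, h3⟩ := hZ z hz
    rw [hg z h3, hr z h3]
    exact h.z_abs z h1
  · intro z hz
    obtain ⟨h1, h2, h3⟩ := hZ z hz
    rw [hg z h3, contract_deg hX hx h2]
    exact h.z_le z h1
  · intro z hz
    obtain ⟨h1, h2, h3⟩ := hZ z hz
    rw [hg z h3, contract_deg hX hx h2]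
    exact h.z_even z h1
  · intro y hy
    by_cases hyx : y = x
    · rw [hyx, hrx, hgx]; linarith
    · rw [hg y hyx, hr y hyx]; exact h.v_abs y (hV y hy hyx).1
  · intro a ha b hb hal hbl hab
    obtain ⟨ha1, ha2⟩ := Finset.mem_erase.1 hal
    obtain ⟨hb1, hb2⟩ := Finset.mem_erase.1 hbl
    rw [hg a ha1, hg b hb1, hr a ha1, hr b hb1]
    exact h.low_pos a (hV a ha ha1).1 b (hV b hb hb1).1 ha2 hb2 hab
  · intro a ha b hb hal hbl hab
    obtain ⟨ha1, ha2⟩ := Finset.mem_erase.1 hal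
    obtain ⟨hb1, hb2⟩ := Finset.mem_erase.1 hbl
    rw [hg a ha1, hg b hb1, hr a ha1, hr b hb1]
    exact h.low_neg a (hV a ha ha1).1 b (hV b hb hb1).1 ha2 hb2 hab
  · intro Y hY y hYy hVy
    obtain ⟨Y', hY', ⟨hxY, rfl, h1, h2⟩ | ⟨rfl, h1, h2⟩⟩ := hcases Y hY
    · have hy : y ∈ Y ∩ (s.contract X x ρ).V := hYy ▸ Finset.mem_singleton_self y
      have hyx : y ≠ x := fun h => hxY (h ▸ (Finset.mem_inter.1 hy).1)
      rw [h2, hg y hyx, hr y hyx]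
      have hc : (s.contract X x ρ).c k y = s.c k y := by simp [c, Net.contract, hyx]
      rw [hc]
      refine h.single Y (hY'.trans Finset.sdiff_subset) y (h1 ▸ hYy) fun hVy' => ?_
      have := Finset.card_le_card (Finset.inter_subset_right (s₁ := X) (s₂ := s.V))
      rw [hVy', Finset.card_singleton, ← hVy'] at this
      omega
    · have hyx : y = x := by
        have : x ∈ insert x Y' ∩ (s.contract X x ρ).V := by rw [h1]; exact Finset.mem_insert_self _ _
        rw [hYy] at this
        exact (Finset.mem_singleton.1 this).symm
      subst hyx
      have h3 : Y' ∩ s.V = ∅ := by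
        rw [Finset.eq_empty_iff_forall_notMem]
        intro a ha
        have : a ∈ ({y} : Finset U) := by rw [← hYy, h1]; exact Finset.mem_insert_of_mem ha
        rw [Finset.mem_singleton] at this
        exact hne a (hY' (Finset.mem_inter.1 ha).1) this
      have h4 : (X ∪ Y') ∩ s.V = X ∩ s.V := by
        rw [Finset.union_inter_distrib_right, h3, Finset.union_empty]
      have h5 := h.multi (X ∪ Y') (Finset.union_subset hX (hY'.trans Finset.sdiff_subset))
        (by rw [h4]; exact hX2) (by rw [h4]; exact hXV)
      have hc : (s.contract X y ρ).c k y = 9 * k := by simp [c, Net.contract]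
      rw [hc, h2, hgx, hrx]
      constructor <;> linarith
  · intro Y hY hY2 hYV
    obtain ⟨Y', hY', ⟨hxY, rfl, h1, h2⟩ | ⟨rfl, h1, h2⟩⟩ := hcases Y hY
    · rw [h2]
      refine h.multi Y (hY'.trans Finset.sdiff_subset) (h1 ▸ hY2) fun hYV' => ?_
      exact hne x (hY' (Finset.mem_inter.1 (show x ∈ Y ∩ s.V by rw [hYV']; exact hxV)).1) rfl
    · rw [h2]
      refine h.multi _ (Finset.union_subset hX (hY'.trans Finset.sdiff_subset)) ?_ fun hYV' => ?_
      · exact hX2.trans (Finset.card_le_card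
          (Finset.inter_subset_inter_right Finset.subset_union_left))
      · apply hYV
        rw [h1]
        ext a
        have h3 := @hX a
        have h4 : a ∈ s.V → a ∈ X ∪ Y' := fun ha =>
          (Finset.mem_inter.1 (show a ∈ (X ∪ Y') ∩ s.V by rw [hYV']; exact ha)).1
        have h5 := @hY' a
        simp [Net.contract] at h4 h5 ⊢
        tauto

end contract

section restrict
variable {s : Net U} {X : Finset U} {η : U → U → ℤ}

lemma restrict_N (hX : X ⊆ s.N) : (s.restrict X η).N = X := by
  rw [N, restrict, ← Finset.union_inter_distrib_right]
  exact Finset.inter_eq_right.2 hX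

lemma restrict_F (hX : X ⊆ s.N) {Y : Finset U} (hY : Y ⊆ X) : (s.restrict X η).F Y = s.F Y := by
  have h1 : s.N \ Y = (X \ Y) ∪ (s.N \ X) := by
    ext a
    have h3 := @hX a
    have h4 := @hY a
    simp only [Finset.mem_sdiff, Finset.mem_union]
    tauto
  have h2 : Disjoint (X \ Y) (s.N \ X) := Finset.disjoint_sdiff.mono_left Finset.sdiff_subset
  simp only [F, cut, restrict_N hX]
  simp only [restrict, h1, Finset.sum_union h2, Finset.sum_add_distrib]
  ring

lemma deg_eq_add (hX : X ⊆ s.N) (w : U → U → ℤ) (a : U) :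
    deg s.N w a = deg X w a + ∑ b ∈ s.N \ X, w a b := by
  rw [deg, deg, ← Finset.sum_sdiff hX, add_comm]

lemma Valid.restrict {k : ℤ} (h : s.Valid k) (hX : X ⊆ s.N) (hXV : X ∩ s.V ≠ s.V) {x : U}
    (hx : x ∈ X) (hxV : x ∈ s.V) (hF : s.F X ≤ 12 * k)
    (hmin : ∀ z ∈ s.Z, z ∈ X → s.F X ≤ s.F (X.erase z))
    (hη : ∀ a ∈ X, ∀ b ∈ s.N \ X, |η a b| ≤ s.w a b ∧ 2 ∣ s.w a b - η a b)
    (hsum : 2 * k ∣ ∑ a ∈ X, s.r a - ∑ a ∈ X, ∑ b ∈ s.N \ X, η a b) :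
    (s.restrict X η).Valid k := by
  have hη1 : ∀ a ∈ X, |∑ b ∈ s.N \ X, η a b| ≤ ∑ b ∈ s.N \ X, s.w a b := fun a ha =>
    (Finset.abs_sum_le_sum_abs _ _).trans (Finset.sum_le_sum fun b hb => (hη a ha b hb).1)
  have hη2 : ∀ a ∈ X, 2 ∣ ∑ b ∈ s.N \ X, s.w a b - ∑ b ∈ s.N \ X, η a b := fun a ha => by
    rw [← Finset.sum_sub_distrib]; exact Finset.dvd_sum fun b hb => (hη a ha b hb).2
  have hN : (s.restrict X η).N = X := restrict_N hX
  have hg : ∀ a, (s.restrict X η).g a = s.g a + ∑ b ∈ s.N \ X, s.w a b := fun _ => rfl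
  have hr : ∀ a, (s.restrict X η).r a = s.r a - ∑ b ∈ s.N \ X, η a b := fun _ => rfl
  have hV : (s.restrict X η).V = s.V ∩ X := rfl
  have hZ : ∀ z ∈ (s.restrict X η).Z, z ∈ s.Z ∧ z ∈ X := fun z hz => Finset.mem_inter.1 hz
  have hwn : ∀ a, 0 ≤ ∑ b ∈ s.N \ X, s.w a b := fun a =>
    Finset.sum_nonneg fun b _ => h.nonneg a b
  have hd : ∀ a, deg s.N s.w a = deg X s.w a + ∑ b ∈ s.N \ X, s.w a b := deg_eq_add hX s.w
  have hw : (s.restrict X η).w = s.w := rfl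
  have hYV : ∀ Y ⊆ X, Y ∩ (s.V ∩ X) = Y ∩ s.V := fun Y hY => by
    ext a; have := @hY a; simp; tauto
  have hYX : ∀ Y ⊆ X, Y ∩ s.V ≠ s.V := fun Y hY hYV => hXV <|
    Finset.Subset.antisymm Finset.inter_subset_right
      (by rw [← hYV]; exact Finset.inter_subset_inter_right hY |>.trans (by rw [hYV]))
  refine ⟨h.disj.mono Finset.inter_subset_left Finset.inter_subset_left,
    ⟨x, Finset.mem_inter.2 ⟨hxV, hx⟩⟩, h.symm, h.nonneg, h.diag, ?_, ?_, ?_, ?_, ?_, ?_, ?_, ?_,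
    ?_, ?_, ?_, ?_, ?_⟩
  · intro a; exact add_nonneg (h.ghost a) (hwn a)
  · intro a ha b hb; exact h.zz a (hZ a ha).1 b (hZ b hb).1
  · intro a ha
    rw [hN] at ha ⊢
    have h1 := h.parity a (hX ha)
    have h2 := hη2 a ha
    rw [hd] at h1
    rw [hr, hw]
    omega
  · rw [hN]
    simp only [hr, Finset.sum_sub_distrib]
    exact hsum
  · rw [hN]
    refine le_trans (le_of_eq ?_) hF
    simp only [hg, Finset.sum_add_distrib, F, cut]
    ring
  · intro z hz
    obtain ⟨h1, h2⟩ := hZ z hz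
    rw [hr, hg]
    exact (abs_sub _ _).trans (add_le_add (h.z_abs z h1) (hη1 z h2))
  · intro z hz
    obtain ⟨h1, h2⟩ := hZ z hz
    have h3 := hmin z h1 h2
    rw [h.F_erase hX h2, Finset.sum_erase _ (h.diag z)] at h3
    have h4 := hd z
    rw [hN, hw, hg]
    simp only [deg] at h3 h4 ⊢
    linarith
  · intro z hz
    obtain ⟨h1, h2⟩ := hZ z hz
    have h3 := h.z_even z h1
    rw [hd] at h3
    rw [hN, hw, hg]
    convert h3 using 1; ring
  · intro y hy
    obtain ⟨h1, h2⟩ := Finset.mem_inter.1 hy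
    rw [hr, hg]
    have := abs_sub (s.r y) (∑ b ∈ s.N \ X, η y b)
    linarith [h.v_abs y h1, hη1 y h2]
  · intro a ha b hb hal hbl hab h'
    obtain ⟨ha1, ha2⟩ := Finset.mem_inter.1 ha
    obtain ⟨hb1, hb2⟩ := Finset.mem_inter.1 hb
    have h3 := abs_le.1 (hη1 a ha2)
    have h4 := abs_le.1 (hη1 b hb2)
    rw [hr, hr, hg, hg] at h'
    exact h.low_pos a ha1 b hb1 hal hbl hab ⟨by linarith [h'.1], by linarith [h'.2]⟩
  · intro a ha b hb hal hbl hab h'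
    obtain ⟨ha1, ha2⟩ := Finset.mem_inter.1 ha
    obtain ⟨hb1, hb2⟩ := Finset.mem_inter.1 hb
    have h3 := abs_le.1 (hη1 a ha2)
    have h4 := abs_le.1 (hη1 b hb2)
    rw [hr, hr, hg, hg] at h'
    exact h.low_neg a ha1 b hb1 hal hbl hab ⟨by linarith [h'.1], by linarith [h'.2]⟩
  · intro Y hY y hYy _
    rw [hN] at hY
    rw [hV, hYV Y hY] at hYy
    have hy : y ∈ Y ∩ s.V := hYy ▸ Finset.mem_singleton_self y
    obtain ⟨h1, h2⟩ := h.single Y (hY.trans hX) y hYy (fun h' => hYX Y hY (by rw [hYy, h']))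
    rw [restrict_F hX hY, hr, hg]
    have h3 := abs_sub (s.r y) (∑ b ∈ s.N \ X, η y b)
    have h4 := hη1 y (hY (Finset.mem_inter.1 hy).1)
    have hc : (s.restrict X η).c k y = s.c k y := rfl
    rw [hc]
    exact ⟨h1, by linarith⟩
  · intro Y hY hY2 _
    rw [hN] at hY
    rw [hV, hYV Y hY] at hY2
    rw [restrict_F hX hY]
    exact h.multi Y (hY.trans hX) hY2 (hYX Y hY)

end restrict

lemma Valid.sol_of_not_slack {k : ℤ} (hk : 2 ≤ k) {s : Net U} (h : s.Valid k) (hs : ¬ s.Slack k)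
    (ih : ∀ t : Net U, t.Smaller s → t.Valid k → t.Sol k) : s.Sol k := by
  let T := s.N.powerset.filter fun X => 2 ≤ (X ∩ s.V).card ∧ X ∩ s.V ≠ s.V
  have hT : ∀ X, X ∈ T ↔ X ⊆ s.N ∧ 2 ≤ (X ∩ s.V).card ∧ X ∩ s.V ≠ s.V := by simp [T]
  unfold Slack at hs
  push Not at hs
  obtain ⟨X₀, h1, h2, h3, h4⟩ := hs
  obtain ⟨X, hXT, hXmin⟩ := T.exists_min_image s.F ⟨X₀, (hT X₀).2 ⟨h1, h2, h3⟩⟩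
  have hF : s.F X ≤ 12 * k := (hXmin X₀ ((hT X₀).2 ⟨h1, h2, h3⟩)).trans h4
  obtain ⟨hX, hX2, hXV⟩ := (hT X).1 hXT
  have hVZ := Finset.disjoint_left.1 h.disj
  have hVN : s.V ⊆ s.N := Finset.subset_union_left
  have hmin : ∀ z ∈ s.Z, z ∈ X → s.F X ≤ s.F (X.erase z) := by
    intro z hz _
    have e : X.erase z ∩ s.V = X ∩ s.V := by
      rw [Finset.erase_inter, Finset.erase_eq_of_notMem]
      exact fun h5 => hVZ (Finset.mem_inter.1 h5).2 hz
    exact hXmin _ ((hT _).2 ⟨(Finset.erase_subset _ _).trans hX, e ▸ hX2, e ▸ hXV⟩)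
  obtain ⟨x, hx'⟩ : (X ∩ s.V).Nonempty := Finset.card_pos.1 (by omega)
  obtain ⟨hx, hxV⟩ := Finset.mem_inter.1 hx'
  obtain ⟨ρ, hρ, hρr⟩ := exists_centered hk (∑ u ∈ X, s.r u)
  have hv1 := h.contract hk hX hX2 hXV hx hxV hρ hρr
  have hcardX : (X ∩ s.V).card < s.V.card := Finset.card_lt_card
    (Finset.inter_subset_right.ssubset_of_ne hXV)
  have hsm1 : (s.contract X x ρ).Smaller s := by
    left
    have e1 := Finset.card_insert_le x (s.V \ X)
    have e2 := Finset.card_sdiff_add_card_inter s.V X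
    rw [Finset.inter_comm] at e2
    change (insert x (s.V \ X)).card < _
    omega
  obtain ⟨ν₁, hν1, hν2, hν3, hν4⟩ := ih _ hsm1 hv1
  have hne : ∀ b ∈ s.N \ X, b ≠ x := fun b hb h => (Finset.mem_sdiff.1 hb).2 (h ▸ hx)
  have hxN : x ∉ s.N \ X := fun h => hne x h rfl
  rw [contract_N] at hν2 hν3 hν4
  have hdist : ∀ b ∈ s.N \ X, ∃ f : U → ℤ, ∑ a ∈ X, f a = ν₁ x b ∧
      ∀ a ∈ X, |f a| ≤ s.w a b ∧ 2 ∣ s.w a b - f a := by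
    intro b hb
    obtain ⟨e1, e2⟩ := hν2 x (Finset.mem_insert_self _ _) b (Finset.mem_insert_of_mem hb)
    rw [contract_w_left (hne b hb)] at e1 e2
    exact exists_distribution X (fun a => s.w a b) (fun a _ => h.nonneg a b) _ e1 e2
  choose! f hf1 hf2 using hdist
  let η : U → U → ℤ := fun a b => f b a
  have hηsum : ∑ a ∈ X, ∑ b ∈ s.N \ X, η a b = ∑ b ∈ s.N \ X, ν₁ x b := by
    rw [Finset.sum_comm]; exact Finset.sum_congr rfl fun b hb => hf1 b hb
  have hνxx : ν₁ x x = 0 := by have := hν1 x x; omega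
  have hsum : 2 * k ∣ ∑ a ∈ X, s.r a - ∑ a ∈ X, ∑ b ∈ s.N \ X, η a b := by
    rw [hηsum]
    have := hν3 x (Finset.mem_insert_self _ _)
    rw [deg, Finset.sum_insert hxN, hνxx, zero_add,
      show (s.contract X x ρ).r x = ρ from Function.update_self _ _ _] at this
    have e := dvd_add this hρr
    rw [sub_add_sub_cancel, ← dvd_neg, neg_sub] at e
    exact e
  have hv2 := h.restrict (η := η) hX hXV hx hxV hF hmin (fun a ha b hb => hf2 b hb a ha) hsum
  have hsm2 : (s.restrict X η).Smaller s := by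
    left
    change (s.V ∩ X).card < _
    rw [Finset.inter_comm]; exact hcardX
  obtain ⟨ν₂, hμ1, hμ2, hμ3, hμ4⟩ := ih _ hsm2 hv2
  rw [restrict_N hX] at hμ2 hμ3 hμ4
  let ν : U → U → ℤ := fun a b =>
    if a ∈ X then (if b ∈ X then ν₂ a b else if b ∈ s.N then η a b else 0)
    else if a ∈ s.N then (if b ∈ X then - η b a else if b ∈ s.N then ν₁ a b else 0) else 0
  have hdX : ∀ a ∈ X, deg s.N ν a = deg X ν₂ a + ∑ b ∈ s.N \ X, η a b := by
    intro a ha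
    rw [deg_eq_add hX]
    congr 1
    · exact Finset.sum_congr rfl fun b hb => by simp [ν, ha, hb]
    · refine Finset.sum_congr rfl fun b hb => ?_
      obtain ⟨e1, e2⟩ := Finset.mem_sdiff.1 hb
      simp [ν, ha, e1, e2]
  have hdN : ∀ a ∈ s.N \ X, deg s.N ν a = deg (insert x (s.N \ X)) ν₁ a := by
    intro a ha
    obtain ⟨ha1, ha2⟩ := Finset.mem_sdiff.1 ha
    rw [deg_eq_add hX, deg, deg, Finset.sum_insert hxN]
    congr 1
    · rw [hν1 a x, ← hf1 a ha, ← Finset.sum_neg_distrib]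
      exact Finset.sum_congr rfl fun b hb => by simp [ν, ha1, ha2, hb, η]
    · refine Finset.sum_congr rfl fun b hb => ?_
      obtain ⟨e1, e2⟩ := Finset.mem_sdiff.1 hb
      simp [ν, ha1, ha2, e1, e2]
  refine ⟨ν, ?_, ?_, ?_, ?_⟩
  · intro a b
    by_cases h1 : a ∈ X <;> by_cases h2 : b ∈ X <;> by_cases h3 : a ∈ s.N <;>
      by_cases h4 : b ∈ s.N <;> simp [ν, h1, h2, h3, h4] <;> first | exact hμ1 a b | exact hν1 a b
  · intro a ha b hb
    by_cases h1 : a ∈ X <;> by_cases h2 : b ∈ X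
    · have e := hμ2 a h1 b h2
      rw [show (s.restrict X η).w = s.w from rfl] at e
      simpa [ν, h1, h2] using e
    · simpa [ν, h1, h2, hb] using hf2 b (Finset.mem_sdiff.2 ⟨hb, h2⟩) a h1
    · obtain ⟨e1, e2⟩ := hf2 a (Finset.mem_sdiff.2 ⟨ha, h1⟩) b h2
      have e3 : ν a b = - f a b := by simp [ν, h1, h2, ha, η]
      rw [e3, abs_neg, h.symm]
      exact ⟨e1, by omega⟩
    · have ha' := Finset.mem_sdiff.2 ⟨ha, h1⟩
      have hb' := Finset.mem_sdiff.2 ⟨hb, h2⟩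
      have e := hν2 a (Finset.mem_insert_of_mem ha') b (Finset.mem_insert_of_mem hb')
      rw [contract_w_of_ne (hne a ha') (hne b hb')] at e
      simpa [ν, h1, h2, ha, hb] using e
  · intro a ha
    by_cases h1 : a ∈ X
    · have e := hμ3 a (Finset.mem_inter.2 ⟨ha, h1⟩)
      rw [hdX a h1]
      change 2 * k ∣ deg X ν₂ a - (s.r a - ∑ b ∈ s.N \ X, η a b) at e
      convert e using 1; ring
    · have ha' := Finset.mem_sdiff.2 ⟨hVN ha, h1⟩
      have e := hν3 a (Finset.mem_insert_of_mem (Finset.mem_sdiff.2 ⟨ha, h1⟩))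
      rw [hdN a ha']
      rwa [show (s.contract X x ρ).r a = s.r a from Function.update_of_ne (hne a ha') _ _] at e
  · intro a ha
    by_cases h1 : a ∈ X
    · have e := hμ4 a (Finset.mem_inter.2 ⟨ha, h1⟩)
      rw [hdX a h1]
      change deg X ν₂ a = s.r a - ∑ b ∈ s.N \ X, η a b at e
      linarith
    · have ha' := Finset.mem_sdiff.2 ⟨Finset.subset_union_right (s₁ := s.V) ha, h1⟩
      have e := hν4 a (Finset.mem_sdiff.2 ⟨ha, h1⟩)
      rw [hdN a ha']
      rwa [show (s.contract X x ρ).r a = s.r a from Function.update_of_ne (hne a ha') _ _] at e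

theorem Valid.sol {k : ℤ} (hk : 2 ≤ k) (s : Net U) : s.Valid k → s.Sol k := by
  refine smaller_wf.induction (C := fun s => s.Valid k → s.Sol k) s fun s ih h => ?_
  by_cases hs : s.Slack k
  · rcases h.sol_or_reducible hk hs with h1 | ⟨t, h1, h2, h3⟩
    · exact h1
    · exact h3 (ih t h2 h1)
  · exact h.sol_of_not_slack hk hs ih

end Net

open Finset in
/-- Integrality of the transportation polytope: a fractional selection of edges of a bipartite
graph with integral degrees can be replaced by a genuine selection with the same degrees. -/
lemma exists_selection_of_fractional {E U : Type} [Fintype E] [Fintype U]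
    [DecidableEq E] [DecidableEq U] (α β : E → U) (n : E → ℤ) {Q : ℤ} (hQ : 0 < Q)
    (hn : ∀ e, 0 ≤ n e ∧ n e ≤ Q) (p q : U → ℤ)
    (hp : ∀ a, ∑ e with α e = a, n e = Q * p a) (hq : ∀ b, ∑ e with β e = b, n e = Q * q b) :
    ∃ H : Finset E, (∀ a, (#{e ∈ H | α e = a} : ℤ) = p a) ∧
      ∀ b, (#{e ∈ H | β e = b} : ℤ) = q b := by
  have hp0 : ∀ a, 0 ≤ p a := fun a => by
    have : 0 ≤ Q * p a := hp a ▸ Finset.sum_nonneg fun e _ => (hn e).1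
    exact nonneg_of_mul_nonneg_right this hQ
  let q' : U → ℤ := fun b => #{e | β e = b} - q b
  have hq' : ∀ b, ∑ e with β e = b, (Q - n e) = Q * q' b := fun b => by
    rw [Finset.sum_sub_distrib, hq, Finset.sum_const, nsmul_eq_mul]; simp only [q']; ring
  have hq0 : ∀ b, 0 ≤ q' b := fun b => by
    have : 0 ≤ Q * q' b := hq' b ▸ Finset.sum_nonneg fun e _ => sub_nonneg.2 (hn e).2
    exact nonneg_of_mul_nonneg_right this hQ
  let t : E → Finset ((Σ _ : U, ℕ) ⊕ (Σ _ : U, ℕ)) := fun e =>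
    (({α e} : Finset U).sigma fun a => Finset.range (p a).toNat).disjSum
      (({β e} : Finset U).sigma fun b => Finset.range (q' b).toNat)
  have hall : ∀ J : Finset E, J.card ≤ (J.biUnion t).card := by
    intro J
    let S := ((J.image α).sigma fun a => Finset.range (p a).toNat).disjSum
      ((J.image β).sigma fun b => Finset.range (q' b).toNat)
    have hS : S ⊆ J.biUnion t := by
      rintro (⟨a, i⟩ | ⟨b, j⟩) h
      · simp [S] at h
        obtain ⟨⟨e, he, rfl⟩, h⟩ := h
        simp only [Finset.mem_biUnion]
        exact ⟨e, he, by simp [t, h]⟩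
      · simp [S] at h
        obtain ⟨⟨e, he, rfl⟩, h⟩ := h
        simp only [Finset.mem_biUnion]
        exact ⟨e, he, by simp [t, h]⟩
    refine le_trans ?_ (Finset.card_le_card hS)
    have hcard : (S.card : ℤ) = ∑ a ∈ J.image α, p a + ∑ b ∈ J.image β, q' b := by
      simp only [S, Finset.card_disjSum, Finset.card_sigma, Finset.card_range]
      push_cast
      congr 1
      · exact Finset.sum_congr rfl fun a _ => by simp [hp0 a]
      · exact Finset.sum_congr rfl fun b _ => by simp [hq0 b]
    have h1 : ∑ e ∈ J, n e ≤ Q * ∑ a ∈ J.image α, p a := by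
      rw [Finset.mul_sum, ← Finset.sum_fiberwise_of_maps_to
        (fun e he => Finset.mem_image_of_mem α he) n]
      refine Finset.sum_le_sum fun a _ => (hp a).symm ▸ ?_
      exact Finset.sum_le_sum_of_subset_of_nonneg
        (Finset.filter_subset_filter _ (Finset.subset_univ J)) fun e _ _ => (hn e).1
    have h2 : ∑ e ∈ J, (Q - n e) ≤ Q * ∑ b ∈ J.image β, q' b := by
      rw [Finset.mul_sum, ← Finset.sum_fiberwise_of_maps_to
        (fun e he => Finset.mem_image_of_mem β he) (fun e => Q - n e)]
      refine Finset.sum_le_sum fun a _ => (hq' a).symm ▸ ?_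
      exact Finset.sum_le_sum_of_subset_of_nonneg
        (Finset.filter_subset_filter _ (Finset.subset_univ J)) fun e _ _ => sub_nonneg.2 (hn e).2
    rw [Finset.sum_sub_distrib, Finset.sum_const, nsmul_eq_mul] at h2
    have h3 : Q * J.card ≤ Q * S.card := by rw [hcard]; linarith
    exact_mod_cast le_of_mul_le_mul_left h3 hQ
  obtain ⟨σ, hσ, hσt⟩ := (Finset.all_card_le_biUnion_card_iff_exists_injective t).1 hall
  let H : Finset E := {e | (σ e).isLeft}
  have hL : ∀ a, (#{e ∈ H | α e = a} : ℤ) ≤ p a := by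
    intro a
    rw [← Int.toNat_of_nonneg (hp0 a), ← Finset.card_range (p a).toNat]
    have : #{e ∈ H | α e = a} ≤ #((Finset.range (p a).toNat).image
        fun i => (Sum.inl ⟨a, i⟩ : (Σ _ : U, ℕ) ⊕ (Σ _ : U, ℕ))) := by
      refine Finset.card_le_card_of_injOn σ ?_ hσ.injOn
      intro e he
      have h1 := hσt e
      obtain ⟨h2, rfl⟩ := Finset.mem_filter.1 he
      simp only [H, Finset.mem_filter] at h2
      rcases h3 : σ e with ⟨x, i⟩ | ⟨x, i⟩
      · rw [h3] at h1
        simp [t] at h1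
        obtain ⟨rfl, h1⟩ := h1
        simp [h1]
      · simp [h3] at h2
    exact_mod_cast this.trans Finset.card_image_le
  have hR : ∀ b, (#{e ∈ Hᶜ | β e = b} : ℤ) ≤ q' b := by
    intro b
    rw [← Int.toNat_of_nonneg (hq0 b), ← Finset.card_range (q' b).toNat]
    have : #{e ∈ Hᶜ | β e = b} ≤ #((Finset.range (q' b).toNat).image
        fun i => (Sum.inr ⟨b, i⟩ : (Σ _ : U, ℕ) ⊕ (Σ _ : U, ℕ))) := by
      refine Finset.card_le_card_of_injOn σ ?_ hσ.injOn
      intro e he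
      have h1 := hσt e
      obtain ⟨h2, rfl⟩ := Finset.mem_filter.1 he
      simp only [H, Finset.mem_compl, Finset.mem_filter] at h2
      rcases h3 : σ e with ⟨x, i⟩ | ⟨x, i⟩
      · simp [h3] at h2
      · rw [h3] at h1
        simp [t] at h1
        obtain ⟨rfl, h1⟩ := h1
        simp [h1]
    exact_mod_cast this.trans Finset.card_image_le
  have hfib : ∀ (γ : E → U) (S : Finset E), ∑ x, (#{e ∈ S | γ e = x} : ℤ) = S.card := by
    intro γ S
    exact_mod_cast (Finset.card_eq_sum_card_fiberwise (f := γ) (s := S) (t := Finset.univ)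
      (fun e _ => Finset.mem_coe.2 (Finset.mem_univ _))).symm
  have htot : ∑ a, p a + ∑ b, q' b = Fintype.card E := by
    have h1 : ∑ e, n e = Q * ∑ a, p a := by
      rw [Finset.mul_sum, ← Finset.sum_fiberwise _ α]
      exact Finset.sum_congr rfl fun a _ => hp a
    have h2 : ∑ e, (Q - n e) = Q * ∑ b, q' b := by
      rw [Finset.mul_sum, ← Finset.sum_fiberwise _ β]
      exact Finset.sum_congr rfl fun a _ => hq' a
    rw [Finset.sum_sub_distrib, Finset.sum_const, nsmul_eq_mul, Finset.card_univ] at h2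
    have h3 : Q * (∑ a, p a + ∑ b, q' b) = Q * Fintype.card E := by linarith
    exact mul_left_cancel₀ hQ.ne' h3
  have hHc : (H.card : ℤ) + Hᶜ.card = Fintype.card E := by exact_mod_cast H.card_add_card_compl
  have hLs := Finset.sum_le_sum fun a (_ : a ∈ (Finset.univ : Finset U)) => hL a
  have hRs := Finset.sum_le_sum fun b (_ : b ∈ (Finset.univ : Finset U)) => hR b
  have hLe := (Finset.sum_eq_sum_iff_of_le fun a _ => hL a).1
    (by rw [hfib] at hLs hRs ⊢; linarith)
  have hRe := (Finset.sum_eq_sum_iff_of_le fun b _ => hR b).1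
    (by rw [hfib] at hLs hRs ⊢; linarith)
  refine ⟨H, fun a => hLe a (Finset.mem_univ a), fun b => ?_⟩
  have h1 := hRe b (Finset.mem_univ b)
  have h2 : #{e ∈ H | β e = b} + #{e ∈ Hᶜ | β e = b} = #{e | β e = b} := by
    rw [← Finset.card_union_of_disjoint, ← Finset.filter_union, Finset.union_compl]
    exact Finset.disjoint_filter_filter disjoint_compl_right
  simp only [q'] at h1
  have h3 : (#{e ∈ H | β e = b} : ℤ) + #{e ∈ Hᶜ | β e = b} = #{e | β e = b} := by exact_mod_cast h2
  linarith

section EdgeFlow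
open Finset
variable {E U : Type} [Fintype E] [DecidableEq U]

/-- The number of edges `e` with `α e = x` and `β e = y`. -/
def pairCount (α β : E → U) (x y : U) : ℤ := ∑ e, if α e = x ∧ β e = y then 1 else 0

variable {α β : E → U}

lemma pairCount_eq_card (x y : U) : pairCount α β x y = (#{e | α e = x ∧ β e = y} : ℤ) := by
  simp [pairCount]

lemma pairCount_nonneg (x y : U) : 0 ≤ pairCount α β x y := by
  rw [pairCount_eq_card]; positivity

lemma sum_pairCount (X Y : Finset U) :
    ∑ x ∈ X, ∑ y ∈ Y, pairCount α β x y = (#{e | α e ∈ X ∧ β e ∈ Y} : ℤ) := by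
  have h : ∀ e : E, ∑ x ∈ X, ∑ y ∈ Y, (if α e = x ∧ β e = y then (1 : ℤ) else 0) =
      if α e ∈ X ∧ β e ∈ Y then 1 else 0 := by
    intro e
    simp only [ite_and, Finset.sum_ite_irrel, Finset.sum_ite_eq, Finset.sum_const_zero]
  simp only [pairCount]
  calc ∑ x ∈ X, ∑ y ∈ Y, ∑ e, (if α e = x ∧ β e = y then (1 : ℤ) else 0)
      = ∑ e, ∑ x ∈ X, ∑ y ∈ Y, (if α e = x ∧ β e = y then (1 : ℤ) else 0) := by
        rw [Finset.sum_comm]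
        simp_rw [Finset.sum_comm (s := X)]
        rw [Finset.sum_comm]
    _ = _ := by rw [Finset.sum_congr rfl fun e _ => h e]; simp

variable [Fintype U] {A B : Finset U}

/-- The net whose edges are those of a bipartite graph, with weight `W` each. -/
def bipartiteNet (α β : E → U) (A B : Finset U) (W : ℤ) (r : U → ℤ) : Net U where
  V := B
  Z := A
  low := ∅
  w x y := W * (pairCount α β x y + pairCount α β y x)
  g _ := 0
  r := r

lemma bipartiteNet_N (hAB : A ∪ B = Finset.univ) (W : ℤ) (r : U → ℤ) :
    (bipartiteNet α β A B W r).N = Finset.univ := by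
  rw [Net.N, Finset.union_comm]; exact hAB

lemma bipartiteNet_F (hAB : A ∪ B = Finset.univ) (W : ℤ) (r : U → ℤ) (X : Finset U) :
    (bipartiteNet α β A B W r).F X = W * (#{e | ¬ (α e ∈ X ↔ β e ∈ X)} : ℤ) := by
  classical
  rw [Net.F, cut, bipartiteNet_N hAB]
  simp only [bipartiteNet, Finset.sum_const_zero, add_zero, ← Finset.mul_sum,
    Finset.sum_add_distrib, sum_pairCount]
  rw [Finset.sum_comm (s := X), sum_pairCount]
  congr 1
  rw [← Nat.cast_add, ← Finset.card_union_of_disjoint, ← Finset.filter_or]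
  · congr 2
    ext e
    simp
    tauto
  · rw [Finset.disjoint_filter]
    intro e _; simp; tauto

lemma bipartiteNet_valid (hα : ∀ e, α e ∈ A) (hβ : ∀ e, β e ∈ B) (hd : Disjoint A B)
    (hAB : A ∪ B = Finset.univ) (hB : B.Nonempty) {W K : ℤ} (hW : 0 ≤ W) (hW2 : 2 ∣ W)
    {r : U → ℤ} (hr2 : ∀ x, 2 ∣ r x) (hrA : ∀ x ∈ A, r x = 0) (hrK : ∀ x, |r x| ≤ 2 * K)
    (hsum : 2 * K ∣ ∑ x, r x)
    (hcut : ∀ X : Finset U, X.Nonempty → X ≠ Finset.univ →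
      12 * K ≤ W * (#{e | ¬ (α e ∈ X ↔ β e ∈ X)} : ℤ)) :
    (bipartiteNet α β A B W r).Valid K := by
  have hN := bipartiteNet_N (α := α) (β := β) hAB W r
  have hdis := Finset.disjoint_left.1 hd
  have hzero : ∀ x y, ¬ (x ∈ A ∧ y ∈ B) → pairCount α β x y = 0 := by
    intro x y h
    refine Finset.sum_eq_zero fun e _ => if_neg ?_
    rintro ⟨rfl, rfl⟩
    exact h ⟨hα e, hβ e⟩
  have hw : ∀ x y, (bipartiteNet α β A B W r).w x y =
    W * (pairCount α β x y + pairCount α β y x) := fun _ _ => rfl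
  have hwn : ∀ x y, 0 ≤ (bipartiteNet α β A B W r).w x y := fun x y =>
    mul_nonneg hW (add_nonneg (pairCount_nonneg _ _) (pairCount_nonneg _ _))
  have hdeg2 : ∀ x, 2 ∣ deg (bipartiteNet α β A B W r).N (bipartiteNet α β A B W r).w x := fun x =>
    Finset.dvd_sum fun y _ => hW2.mul_right _
  have hK : 0 ≤ K := by
    obtain ⟨b, _⟩ := hB
    have := (abs_nonneg _).trans (hrK b)
    linarith
  have hF : ∀ X, (X ∩ B).Nonempty → X ∩ B ≠ B →
      12 * K ≤ (bipartiteNet α β A B W r).F X := by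
    intro X h1 h2
    rw [bipartiteNet_F hAB]
    refine hcut X (h1.mono Finset.inter_subset_left) fun h => h2 ?_
    rw [h, Finset.univ_inter]
  refine ⟨hd.symm, hB, ?_, hwn, ?_, fun _ => le_rfl, ?_, ?_, ?_, ?_, ?_, ?_, ?_, ?_, ?_, ?_, ?_, ?_⟩
  · intro x y; rw [hw, hw, add_comm]
  · intro x; rw [hw, hzero x x fun h => hdis h.1 h.2]; simp
  · intro x hx y hy
    rw [hw, hzero x y fun h => hdis hy h.2, hzero y x fun h => hdis hx h.2]; simp
  · intro x _; exact dvd_sub (hdeg2 x) (hr2 x)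
  · rw [hN]; exact hsum
  · simp only [bipartiteNet, Finset.sum_const_zero]; linarith
  · intro z hz; simp [bipartiteNet, hrA z hz]
  · intro z _; exact Finset.sum_nonneg fun y _ => hwn z y
  · intro z _; exact dvd_add (hdeg2 z) (dvd_zero 2)
  · intro y _; simpa [bipartiteNet] using hrK y
  · intro x _ y _ hx; exact absurd hx (Finset.notMem_empty x)
  · intro x _ y _ hx; exact absurd hx (Finset.notMem_empty x)
  · intro X _ y hXy hBy
    have h1 := hF X (by rw [show X ∩ B = {y} from hXy]; exact Finset.singleton_nonempty y)
      (fun h => hBy (h.symm.trans hXy))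
    have h2 : (bipartiteNet α β A B W r).c K y = 9 * K := by simp [Net.c, bipartiteNet]
    have h3 : |(bipartiteNet α β A B W r).r y| ≤ 2 * K := hrK y
    have h4 : (bipartiteNet α β A B W r).g y = 0 := rfl
    rw [h2, h4]
    constructor <;> linarith
  · intro X _ hX hXB
    have := hF X (Finset.card_pos.1 (by change 2 ≤ (X ∩ B).card at hX; omega)) hXB
    linarith

/-- Solving the net of a bipartite graph edge by edge. -/
lemma exists_edge_flow (hα : ∀ e, α e ∈ A) (hβ : ∀ e, β e ∈ B) (hd : Disjoint A B)
    (hAB : A ∪ B = Finset.univ) (hB : B.Nonempty) {W K : ℤ} (hK : 2 ≤ K) (hW : 0 ≤ W) (hW2 : 2 ∣ W)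
    {r : U → ℤ} (hr2 : ∀ x, 2 ∣ r x) (hrA : ∀ x ∈ A, r x = 0) (hrK : ∀ x, |r x| ≤ 2 * K)
    (hsum : 2 * K ∣ ∑ x, r x)
    (hcut : ∀ X : Finset U, X.Nonempty → X ≠ Finset.univ →
      12 * K ≤ W * (#{e | ¬ (α e ∈ X ↔ β e ∈ X)} : ℤ)) :
    ∃ f : E → ℤ, (∀ e, |f e| ≤ W) ∧ (∀ a ∈ A, ∑ e with α e = a, f e = 0) ∧
      ∀ b ∈ B, 2 * K ∣ ∑ e with β e = b, f e - r b := by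
  have hdis := Finset.disjoint_left.1 hd
  have hv := bipartiteNet_valid hα hβ hd hAB hB hW hW2 hr2 hrA hrK hsum hcut
  obtain ⟨ν, h1, h2, h3, h4⟩ := Net.Valid.sol hK _ hv
  rw [bipartiteNet_N hAB] at h2 h3 h4
  have hzero : ∀ x y, ¬ (x ∈ A ∧ y ∈ B) → pairCount α β x y = 0 := by
    intro x y h
    refine Finset.sum_eq_zero fun e _ => if_neg ?_
    rintro ⟨rfl, rfl⟩
    exact h ⟨hα e, hβ e⟩
  have hν : ∀ x y, x ∉ B → y ∉ B → ν x y = 0 := by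
    intro x y hx hy
    have := (h2 x (Finset.mem_univ x) y (Finset.mem_univ y)).1
    change _ ≤ W * _ at this
    rw [hzero x y fun h => hy h.2, hzero y x fun h => hx h.2] at this
    simpa using this
  have hdist : ∀ x y, ∃ f : E → ℤ, y ∈ B → ∑ e with α e = x ∧ β e = y, f e = ν y x ∧
      ∀ e, α e = x ∧ β e = y → |f e| ≤ W := by
    intro x y
    by_cases hy : y ∈ B
    · obtain ⟨e1, e2⟩ := h2 y (Finset.mem_univ y) x (Finset.mem_univ x)
      have e3 : (bipartiteNet α β A B W r).w y x = ∑ e : E with α e = x ∧ β e = y, W := by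
        change W * _ = _
        rw [hzero y x fun h => hdis h.1 hy, zero_add, Finset.sum_const, pairCount_eq_card,
          nsmul_eq_mul, mul_comm]
      rw [e3] at e1 e2
      obtain ⟨f, hf1, hf2⟩ := exists_distribution _ (fun _ => W) (fun _ _ => hW) _ e1 e2
      exact ⟨f, fun _ => ⟨hf1, fun e he => (hf2 e (by simpa using he)).1⟩⟩
    · exact ⟨0, fun h => absurd h hy⟩
  choose φ hφ using hdist
  let f : E → ℤ := fun e => φ (α e) (β e) e
  have hf : ∀ x, ∀ y ∈ B, ∑ e with α e = x ∧ β e = y, f e = ν y x := by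
    intro x y hy
    rw [← (hφ x y hy).1]
    refine Finset.sum_congr rfl fun e he => ?_
    obtain ⟨-, rfl, rfl⟩ := Finset.mem_filter.1 he
    rfl
  refine ⟨f, fun e => (hφ _ _ (hβ e)).2 e ⟨rfl, rfl⟩, ?_, ?_⟩
  · intro a ha
    have h5 := h4 a ha
    rw [show (bipartiteNet α β A B W r).r a = 0 from hrA a ha] at h5
    rw [← Finset.sum_fiberwise _ β]
    rw [← neg_eq_zero, deg, ← Finset.sum_neg_distrib] at h5
    rw [← h5]
    refine Finset.sum_congr rfl fun y _ => ?_
    rw [Finset.filter_filter, ← h1]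
    by_cases hy : y ∈ B
    · exact hf a y hy
    · rw [hν y a hy (hdis ha)]
      refine Finset.sum_eq_zero fun e he => absurd (hβ e) ?_
      rw [(Finset.mem_filter.1 he).2.2]; exact hy
  · intro b hb
    have h5 := h3 b hb
    change 2 * K ∣ _ - r b at h5
    convert h5 using 2
    rw [← Finset.sum_fiberwise _ α, deg]
    refine Finset.sum_congr rfl fun x _ => ?_
    rw [Finset.filter_filter, ← hf x b hb]
    simp only [and_comm]

end EdgeFlow
section Selection
open Finset

/-- The combinatorial form of the decomposition theorem, for a bipartite graph whose edge `e` joins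
`α e ∈ A` and `β e ∈ B`. -/
theorem exists_selection {E U : Type} [Fintype E] [Fintype U] [DecidableEq E] [DecidableEq U]
    {α β : E → U} {A B : Finset U} (hα : ∀ e, α e ∈ A) (hβ : ∀ e, β e ∈ B) (hd : Disjoint A B)
    (hAB : A ∪ B = univ) {k l m : ℕ} (hk : 1 < k) (hkl : k ≤ l) (hm : m = k + l - 1)
    (hdeg : ∀ a ∈ A, m ∣ #{e | α e = a})
    (hcut : ∀ X : Finset U, X.Nonempty → X ≠ univ →
      6 * l * m ≤ (k - 1) * #{e | ¬ (α e ∈ X ↔ β e ∈ X)}) :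
    ∃ H : Finset E, (∀ a ∈ A, m * #{e ∈ H | α e = a} = (k - 1) * #{e | α e = a}) ∧
      ∀ b ∈ B, l ∣ #{e ∈ Hᶜ | β e = b} := by
  rcases B.eq_empty_or_nonempty with rfl | hB
  · have : IsEmpty E := ⟨fun e => Finset.notMem_empty _ (hβ e)⟩
    exact ⟨∅, by simp, by simp⟩
  obtain ⟨c, rfl⟩ : ∃ c, k = c + 1 := ⟨k - 1, by omega⟩
  obtain rfl : m = c + l := by omega
  rw [Nat.add_sub_cancel] at hcut ⊢
  let K : ℤ := (c + l) * l
  have hK : 2 ≤ K := by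
    have h1 : (2 : ℤ) ≤ l := by omega
    have h2 : (0 : ℤ) ≤ c := by omega
    simp only [K]; nlinarith
  let r : U → ℤ := fun x => if x ∈ B then (2 * l * (#{e | β e = x} : ℤ)) % (2 * K) else 0
  have hrB : ∀ b ∈ B, 2 * K ∣ r b - 2 * l * (#{e | β e = b} : ℤ) := by
    intro b hb
    simp only [r, hb, if_true]
    rw [← dvd_neg, neg_sub]
    exact Int.dvd_self_sub_emod
  have hrA : ∀ x ∉ B, r x = 0 := fun x hx => by simp [r, hx]
  have hr2 : ∀ x, 2 ∣ r x := by
    intro x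
    by_cases hx : x ∈ B
    · have h1 := (dvd_mul_right 2 K).trans (hrB x hx)
      have h2 : (2 : ℤ) ∣ 2 * l * (#{e | β e = x} : ℤ) := ⟨l * #{e | β e = x}, by ring⟩
      exact (dvd_sub_left h2).1 h1
    · rw [hrA x hx]; exact dvd_zero 2
  have hrK : ∀ x, |r x| ≤ 2 * K := by
    intro x
    by_cases hx : x ∈ B
    · simp only [r, hx, if_true]
      have h1 := Int.emod_nonneg (2 * l * (#{e | β e = x} : ℤ)) (b := 2 * K) (by omega)
      have h2 := Int.emod_lt_of_pos (2 * l * (#{e | β e = x} : ℤ)) (b := 2 * K) (by omega)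
      rw [abs_of_nonneg h1]; exact h2.le
    · rw [hrA x hx, abs_zero]; omega
  have hE : ∀ (γ : E → U) (S : Finset U), (∀ e, γ e ∈ S) →
      ∑ x ∈ S, #{e | γ e = x} = Fintype.card E := fun γ S hγ =>
    (card_eq_sum_card_fiberwise fun e _ => hγ e).symm
  have hsum : 2 * K ∣ ∑ x, r x := by
    have h1 : ∑ x, r x = ∑ b ∈ B, r b :=
      (sum_subset (subset_univ B) fun x _ hx => hrA x hx).symm
    have h2 : 2 * K ∣ ∑ b ∈ B, (r b - 2 * l * (#{e | β e = b} : ℤ)) := dvd_sum hrB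
    rw [sum_sub_distrib, ← mul_sum, ← Nat.cast_sum, hE β B hβ] at h2
    rw [h1]
    refine (dvd_sub_left ?_).1 h2
    obtain ⟨t, ht⟩ : c + l ∣ Fintype.card E := hE α A hα ▸ dvd_sum hdeg
    refine ⟨t, ?_⟩
    rw [ht]; simp only [K]; push_cast; ring
  obtain ⟨f, hf1, hf2, hf3⟩ := exists_edge_flow hα hβ hd hAB hB (W := 2 * c) hK (by positivity)
    (dvd_mul_right 2 _) hr2 (fun x hx => hrA x (Finset.disjoint_left.1 hd hx)) hrK hsum (by
      intro X h1 h2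
      have h3 : ((6 * l * (c + l) : ℕ) : ℤ) ≤ ((c * #{e | ¬ (α e ∈ X ↔ β e ∈ X)} : ℕ) : ℤ) :=
        Nat.cast_le.2 (hcut X h1 h2)
      push_cast at h3
      simp only [K]
      linarith)
  have hsumn : ∀ (γ : E → U) (x : U), ∑ e with γ e = x, (2 * c + f e) =
      2 * c * (#{e | γ e = x} : ℤ) + ∑ e with γ e = x, f e := by
    intro γ x
    rw [sum_add_distrib, sum_const, nsmul_eq_mul, mul_comm]
  have hp : ∀ a, ∃ p : ℤ, ∑ e with α e = a, (2 * c + f e) = (2 * (c + l)) * p ∧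
      (a ∈ A → (c + l) * p = c * #{e | α e = a}) := by
    intro a
    by_cases ha : a ∈ A
    · obtain ⟨t, ht⟩ := hdeg a ha
      refine ⟨c * t, ?_, fun _ => ?_⟩
      · rw [hsumn, hf2 a ha, ht]; push_cast; ring
      · rw [ht]; push_cast; ring
    · refine ⟨0, ?_, fun h => absurd h ha⟩
      rw [mul_zero]
      refine sum_eq_zero fun e he => absurd (hα e) ?_
      rw [(mem_filter.1 he).2]; exact ha
  have hq : ∀ b, ∃ q : ℤ, ∑ e with β e = b, (2 * c + f e) = (2 * (c + l)) * q ∧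
      (b ∈ B → (l : ℤ) ∣ #{e | β e = b} - q) := by
    intro b
    by_cases hb : b ∈ B
    · obtain ⟨j, hj⟩ := dvd_add (hf3 b hb) (hrB b hb)
      refine ⟨#{e | β e = b} + l * j, ?_, fun _ => ⟨-j, by ring⟩⟩
      rw [hsumn]
      simp only [K] at hj
      linarith
    · refine ⟨0, ?_, fun h => absurd h hb⟩
      rw [mul_zero]
      refine sum_eq_zero fun e he => absurd (hβ e) ?_
      rw [(mem_filter.1 he).2]; exact hb
  choose p hp1 hp2 using hp
  choose q hq1 hq2 using hq
  obtain ⟨H, hH1, hH2⟩ := exists_selection_of_fractional α β (fun e => 2 * c + f e)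
    (Q := 2 * (c + l)) (by omega) (fun e => by
      have := abs_le.1 (hf1 e)
      constructor <;> omega) p q hp1 hq1
  refine ⟨H, fun a ha => ?_, fun b hb => ?_⟩
  · have := hp2 a ha
    rw [← hH1 a] at this
    exact_mod_cast this
  · have h1 := hq2 b hb
    rw [← hH2 b] at h1
    have h2 : #{e ∈ H | β e = b} + #{e ∈ Hᶜ | β e = b} = #{e | β e = b} := by
      rw [← card_union_of_disjoint, ← filter_union, union_compl]
      exact disjoint_filter_filter disjoint_compl_right
    rw [← h2] at h1
    push_cast at h1
    rw [add_sub_cancel_left] at h1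
    exact_mod_cast h1

end Selection
end ModFlow

namespace Multigraph

variable {V E : Type}

/-- Every edge cut of a `k`-edge-connected graph has at least `k` edges. -/
lemma EdgeConnected.le_card_cut [Fintype E] [DecidableEq V] {G : Multigraph V E} {k : ℕ}
    (hG : G.EdgeConnected k) {α β : E → V} (hends : ∀ e, G.ends e = s(α e, β e)) {X : Finset V}
    {x y : V} (hx : x ∈ X) (hy : y ∉ X) :
    k ≤ (Finset.univ.filter fun e => ¬ (α e ∈ X ↔ β e ∈ X)).card := by
  by_contra h
  rw [not_le] at h
  refine hy ?_
  clear hy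
  induction hG _ h x y with
  | refl => exact hx
  | tail _ hbc ih =>
    obtain ⟨e, he, heq⟩ := hbc
    have he' : e ∉ Finset.univ.filter fun e => ¬ (α e ∈ X ↔ β e ∈ X) := he
    rw [Finset.mem_filter] at he'
    rw [hends, Sym2.eq_iff] at heq
    rcases heq with ⟨rfl, rfl⟩ | ⟨rfl, rfl⟩ <;> simp at he' <;> tauto

end Multigraph

open Multigraph in
/-- for `1 < k ≤ l` and `m = k + l - 1`, a `3l⌈2m/(k-1)⌉`-edge-connected
bipartite graph with all `A`-degrees divisible by `m` decomposes into `G1 = H` and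
`G2 = Hᶜ` with `d(v,G1) = ((k-1)/m)·d(v,G)` for `v ∈ A` and `l ∣ d(v,G2)` for `v ∈ B`. -/
theorem bistar_degree_decomposition {V E : Type} [Fintype V] [Fintype E]
    (G : Multigraph V E) (A B : Set V) (k l m : ℕ)
    (hk : 1 < k) (hkl : k ≤ l) (hm : m = k + l - 1)
    (hbip : G.IsBipartition A B)
    (hdeg : ∀ v ∈ A, m ∣ G.deg v)
    (hcon : G.EdgeConnected (3 * l * ((2 * m + k - 2) / (k - 1)))) :
    ∃ H : Set E, (∀ v ∈ A, m * G.degOn H v = (k - 1) * G.deg v) ∧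
      ∀ v ∈ B, l ∣ G.degOn Hᶜ v := by
  classical
  obtain ⟨hd, hAB, hends⟩ := hbip
  choose α hα β hβ hends using hends
  have hAB' : A.toFinset ∪ B.toFinset = Finset.univ := by
    rw [← Set.toFinset_union, ← Set.toFinset_univ]; simp only [hAB]
  have hmemA : ∀ v ∈ A, ∀ e, v ∈ G.ends e ↔ α e = v := by
    intro v hv e
    rw [hends, Sym2.mem_iff]
    refine ⟨?_, fun h => Or.inl h.symm⟩
    rintro (rfl | rfl)
    · rfl
    · exact absurd (hβ e) (Set.disjoint_left.1 hd hv)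
  have hmemB : ∀ v ∈ B, ∀ e, v ∈ G.ends e ↔ β e = v := by
    intro v hv e
    rw [hends, Sym2.mem_iff]
    refine ⟨?_, fun h => Or.inr h.symm⟩
    rintro (rfl | rfl)
    · exact absurd hv (Set.disjoint_left.1 hd (hα e))
    · rfl
  have hdegA : ∀ v ∈ A, G.deg v = (Finset.univ.filter fun e => α e = v).card := by
    intro v hv
    rw [deg, Nat.card_eq_fintype_card, Fintype.card_subtype]
    simp only [hmemA v hv]
  have hdegOn : ∀ (H : Finset E) (v : V),
      G.degOn (H : Set E) v = (H.filter fun e => v ∈ G.ends e).card := by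
    intro H v
    rw [degOn, Nat.card_eq_fintype_card, Fintype.card_subtype]
    congr 1
    ext e
    simp
  obtain ⟨H, hH1, hH2⟩ := ModFlow.exists_selection (A := A.toFinset) (B := B.toFinset)
    (α := α) (β := β) (fun e => Set.mem_toFinset.2 (hα e)) (fun e => Set.mem_toFinset.2 (hβ e))
    (Set.disjoint_toFinset.2 hd) hAB' hk hkl hm
    (fun a ha => hdegA a (Set.mem_toFinset.1 ha) ▸ hdeg a (Set.mem_toFinset.1 ha)) (by
      intro X ⟨x, hx⟩ hX
      obtain ⟨y, hy⟩ : ∃ y, y ∉ X := by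
        by_contra! h
        exact hX (Finset.eq_univ_iff_forall.2 h)
      have hceil : 2 * m ≤ (k - 1) * ((2 * m + k - 2) / (k - 1)) := by
        have h1 := Nat.div_add_mod (2 * m + k - 2) (k - 1)
        have h2 := Nat.mod_lt (2 * m + k - 2) (y := k - 1) (by omega)
        omega
      calc 6 * l * m = 3 * l * (2 * m) := by ring
        _ ≤ 3 * l * ((k - 1) * ((2 * m + k - 2) / (k - 1))) := Nat.mul_le_mul_left _ hceil
        _ = (k - 1) * (3 * l * ((2 * m + k - 2) / (k - 1))) := by ring
        _ ≤ _ := Nat.mul_le_mul_left _ (hcon.le_card_cut hends hx hy))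
  refine ⟨H, fun v hv => ?_, fun v hv => ?_⟩
  · rw [hdegOn, hdegA v hv]
    simp only [hmemA v hv]
    exact hH1 v (Set.mem_toFinset.2 hv)
  · rw [← Finset.coe_compl, hdegOn]
    simp only [hmemB v hv]
    exact hH2 v (Set.mem_toFinset.2 hv)
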